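/- arXiv:2012.15011 — 2 statements merged into one kernel-verified Lean document; each statement's English description precedes it below -/
import Mathlib

section
/- Let m ≥ ℓ ≥ 1 and n ≥ 1, with variables x = (x_1,…,x_n) and t = (t_1,…,t_ℓ). Then the following Littlewood-type identity holds: s_{m^ℓ}(x_1,…,x_n, t_1,…,t_ℓ) = Σ_{λ ⊆ m^ℓ} (∏_{i=1}^{ℓ} t_i^{m−λ_i}) · g_λ(x; t_1,…,t_{ℓ−1}), where the sum is over all partitions λ contained in the ℓ×m rectangle. -/
open scoped Classical

noncomputable section

variable {R : Type*} [CommRing R]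

/-- The boxes of the Young diagram with row lengths `lam 0, …, lam (ℓ-1)`
(a box in row `r < ℓ` and column `c < lam r`, both 0-indexed). -/
abbrev YBox (ℓ : ℕ) (lam : ℕ → ℕ) : Type := Σ r : Fin ℓ, Fin (lam r.1)

/-- A reverse plane partition of skew shape `lam/mu` with entries in `{1, …, n}`,
encoded as a filling of the boxes of `lam` by values in `Fin (n+1)`, where the
value `0` is used exactly on the boxes of `mu`; rows weakly increase and
columns weakly increase. -/
def IsSkewRPP (ℓ n : ℕ) (lam mu : ℕ → ℕ) (T : YBox ℓ lam → Fin (n + 1)) : Prop :=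
  (∀ b : YBox ℓ lam, ((T b : ℕ) = 0 ↔ (b.2 : ℕ) < mu b.1.1)) ∧
  (∀ (r : Fin ℓ) (c c' : Fin (lam r.1)), mu r.1 ≤ (c : ℕ) → (c : ℕ) ≤ (c' : ℕ) →
    T ⟨r, c⟩ ≤ T ⟨r, c'⟩) ∧
  (∀ (r r' : Fin ℓ) (c : Fin (lam r.1)) (c' : Fin (lam r'.1)),
    (r : ℕ) ≤ (r' : ℕ) → (c : ℕ) = (c' : ℕ) → mu r.1 ≤ (c : ℕ) → mu r'.1 ≤ (c' : ℕ) →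
    T ⟨r, c⟩ ≤ T ⟨r', c'⟩)

/-- The weight of a box `b` of the skew shape `lam/mu` in a reverse plane
partition `T`: it is `t (r+1)` (`r+1` being the 1-indexed row of `b`) if the box
directly below `b` exists (in `lam`) and carries the same entry, and `x e`
otherwise, where `e ∈ {1, …, n}` is the entry of `b`.  Boxes of `mu` have
weight `1`. -/
def boxWeight (ℓ n : ℕ) (lam mu : ℕ → ℕ) (x t : ℕ → R)
    (T : YBox ℓ lam → Fin (n + 1)) (b : YBox ℓ lam) : R :=
  if mu b.1.1 ≤ (b.2 : ℕ) then
    if ∃ (hr : (b.1 : ℕ) + 1 < ℓ) (hc : (b.2 : ℕ) < lam ((b.1 : ℕ) + 1)),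
        T ⟨⟨(b.1 : ℕ) + 1, hr⟩, ⟨(b.2 : ℕ), hc⟩⟩ = T b
      then t ((b.1 : ℕ) + 1)
      else x (T b : ℕ)
  else 1

/-- The (skew) refined dual Grothendieck polynomial `g_{lam/mu}(x; t)`:
the sum of `∏_r t_r^{b_r(T)} ∏_i x_i^{a_i(T)}` over all reverse plane
partitions `T` of shape `lam/mu` with entries in `{1, …, n}`, where `b_r(T)`
is the number of boxes in row `r` whose entry equals that of the box directly
below it, and `a_i(T)` is the number of columns containing the entry `i`. -/
def dualGroth (ℓ n : ℕ) (lam mu : ℕ → ℕ) (x t : ℕ → R) : R :=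
  ∑ T ∈ Finset.univ.filter (IsSkewRPP ℓ n lam mu),
    ∏ b : YBox ℓ lam, boxWeight ℓ n lam mu x t T b

/-- Complete homogeneous symmetric function `h_k` of the entries of a list. -/
def hL (k : ℕ) (L : List R) : R :=
  ∑ f ∈ Finset.univ.filter (fun f : Fin k → Fin L.length => Monotone f),
    ∏ i, L.get (f i)

/-- Elementary symmetric function `e_k` of the entries of a list. -/
def eL (k : ℕ) (L : List R) : R :=
  ∑ f ∈ Finset.univ.filter (fun f : Fin k → Fin L.length => StrictMono f),
    ∏ i, L.get (f i)

/-- `h_d` for an integer degree `d`, with `h_d = 0` for `d < 0`. -/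
def hInt (d : ℤ) (L : List R) : R := if 0 ≤ d then hL d.toNat L else 0

/-- `e_d` for an integer degree `d`, with `e_d = 0` for `d < 0`. -/
def eInt (d : ℤ) (L : List R) : R := if 0 ≤ d then eL d.toNat L else 0

/-- Extend a function on `Fin ℓ` to `ℕ` by `0`. -/
def extendFin (ℓ : ℕ) (p : Fin ℓ → ℕ) : ℕ → ℕ :=
  fun r => if h : r < ℓ then p ⟨r, h⟩ else 0

/-- A semistandard Young tableau of shape `lam` with entries in `{1, …, N}`
(encoded with values in `Fin (N+1)`, the value `0` being unused): rows weakly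
increase and columns strictly increase. -/
def IsSSYT (ℓ N : ℕ) (lam : ℕ → ℕ) (T : YBox ℓ lam → Fin (N + 1)) : Prop :=
  (∀ b : YBox ℓ lam, 1 ≤ (T b : ℕ)) ∧
  (∀ (r : Fin ℓ) (c c' : Fin (lam r.1)), (c : ℕ) ≤ (c' : ℕ) → T ⟨r, c⟩ ≤ T ⟨r, c'⟩) ∧
  (∀ (r r' : Fin ℓ) (c : Fin (lam r.1)) (c' : Fin (lam r'.1)),
    (r : ℕ) < (r' : ℕ) → (c : ℕ) = (c' : ℕ) → T ⟨r, c⟩ < T ⟨r', c'⟩)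

/-- The Schur polynomial `s_lam (z 1, …, z N)`: the sum of `z^T` over all
semistandard Young tableaux of shape `lam` with entries in `{1, …, N}`. -/
def schurPoly (ℓ N : ℕ) (lam : ℕ → ℕ) (z : ℕ → R) : R :=
  ∑ T ∈ Finset.univ.filter (IsSSYT ℓ N lam),
    ∏ b : YBox ℓ lam, z (T b : ℕ)


/-- The shapes contained in the `ℓ × m` rectangle, as antitone functions `ℕ → ℕ`. -/
def BoxedShape (ℓ m : ℕ) : Type :=
  {f : ℕ → ℕ // Antitone f ∧ (∀ r, ℓ ≤ r → f r = 0) ∧ ∀ r, f r ≤ m}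

namespace BoxedShape

variable {ℓ m : ℕ}

instance : CoeFun (BoxedShape ℓ m) fun _ => ℕ → ℕ := ⟨fun s => s.1⟩

@[ext]
theorem ext {s s' : BoxedShape ℓ m} (h : ∀ r, s r = s' r) : s = s' :=
  Subtype.ext (funext h)

theorem anti (s : BoxedShape ℓ m) {a b : ℕ} (h : a ≤ b) : s b ≤ s a := s.2.1 h

theorem succ_le (s : BoxedShape ℓ m) (a : ℕ) : s (a + 1) ≤ s a := s.anti a.le_succ

theorem eq_zero (s : BoxedShape ℓ m) {r : ℕ} (h : ℓ ≤ r) : s r = 0 := s.2.2.1 r h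

theorem le_width (s : BoxedShape ℓ m) (r : ℕ) : s r ≤ m := s.2.2.2 r

instance : Finite (BoxedShape ℓ m) :=
  Finite.of_injective
    (fun (s : BoxedShape ℓ m) (r : Fin ℓ) => (⟨s r, Nat.lt_succ_of_le (s.le_width r)⟩ : Fin (m + 1)))
    fun s s' h => by
      ext r
      by_cases hr : r < ℓ
      · simpa using congrFun h ⟨r, hr⟩
      · rw [s.eq_zero (not_lt.1 hr), s'.eq_zero (not_lt.1 hr)]

instance : Fintype (BoxedShape ℓ m) := Fintype.ofFinite _

/-- The empty shape. -/
def empty (ℓ m : ℕ) : BoxedShape ℓ m :=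
  ⟨fun _ => 0, antitone_const, fun _ _ => rfl, fun _ => Nat.zero_le _⟩

/-- The full `ℓ × m` rectangle. -/
def full (ℓ m : ℕ) : BoxedShape ℓ m :=
  ⟨fun r => if r < ℓ then m else 0, fun a b h => by dsimp only; split_ifs <;> omega,
    fun r h => by simp [h], fun r => by dsimp only; split_ifs <;> omega⟩

theorem full_apply {r : ℕ} (h : r < ℓ) : full ℓ m r = m := if_pos h

end BoxedShape

/-- The dual Grothendieck polynomial of `lam/mu` in the single variable `x`. -/
def dualGrothStep (ℓ : ℕ) (t : ℕ → R) (x : R) (lam mu : ℕ → ℕ) : R :=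
  if ∀ r, mu r ≤ lam r then
    ∏ r ∈ Finset.range ℓ, t r ^ (lam (r + 1) - mu r) * x ^ (lam r - max (mu r) (lam (r + 1)))
  else 0

/-- The weight of adding to `mu` a horizontal strip, all of whose boxes have weight `y` and
lie below the first `k` rows, in order to obtain `lam`. -/
def stripStep (ℓ k : ℕ) (y : R) (lam mu : ℕ → ℕ) : R :=
  if (∀ r, mu r ≤ lam r ∧ lam (r + 1) ≤ mu r) ∧ ∀ r < k, lam r = mu r then
    y ^ ∑ r ∈ Finset.Ico k ℓ, (lam r - mu r)
  else 0

/-- The sequence `t 1, …, t k, 0, 0, …`. -/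
def truncParam (t : ℕ → R) (k : ℕ) : ℕ → R := fun r => if r < k then t (r + 1) else 0

theorem dualGrothStep_truncParam {ℓ m k : ℕ} (hk : k ≤ ℓ) (t : ℕ → R) (x : R)
    (lam mu : BoxedShape ℓ m) :
    dualGrothStep ℓ (truncParam t k) x lam mu =
      if (∀ r, mu r ≤ lam r) ∧ ∀ r, k ≤ r → lam (r + 1) ≤ mu r then
        (∏ r ∈ Finset.range k,
          t (r + 1) ^ (lam (r + 1) - mu r) * x ^ (lam r - max (mu r) (lam (r + 1)))) *
        x ^ ∑ r ∈ Finset.Ico k ℓ, (lam r - mu r)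
      else 0 := by
  unfold dualGrothStep
  by_cases h₁ : ∀ r, mu r ≤ lam r
  swap
  · rw [if_neg h₁, if_neg fun h => h₁ h.1]
  rw [if_pos h₁, ← Finset.prod_range_mul_prod_Ico _ hk]
  by_cases h₂ : ∀ r, k ≤ r → lam (r + 1) ≤ mu r
  · rw [if_pos ⟨h₁, h₂⟩, ← Finset.prod_pow_eq_pow_sum]
    congr 1
    · refine Finset.prod_congr rfl fun r hr => ?_
      rw [truncParam, if_pos (Finset.mem_range.1 hr)]
    · refine Finset.prod_congr rfl fun r hr => ?_
      have hr' := h₂ r (Finset.mem_Ico.1 hr).1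
      rw [Nat.sub_eq_zero_of_le hr', max_eq_left hr', pow_zero, one_mul]
  · rw [if_neg fun h => h₂ h.2]
    push Not at h₂
    obtain ⟨r, hkr, hr⟩ := h₂
    have hrℓ : r < ℓ := by
      by_contra hc
      rw [lam.eq_zero (r := r + 1) (by omega)] at hr
      omega
    rw [Finset.prod_eq_zero (i := r) (s := Finset.Ico k ℓ) (Finset.mem_Ico.2 ⟨hkr, hrℓ⟩),
      mul_zero]
    rw [truncParam, if_neg (by omega), zero_pow (by omega), zero_mul]

theorem dualGrothStep_truncParam_zero {ℓ m : ℕ} (t : ℕ → R) (x : R) (lam mu : BoxedShape ℓ m) :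
    dualGrothStep ℓ (truncParam t 0) x lam mu = stripStep ℓ 0 x lam mu := by
  rw [dualGrothStep_truncParam (Nat.zero_le ℓ), stripStep]
  simp [forall_and]

/-- The least possible length of row `r` in a shape between `mu` and `lam`. -/
def rowLo (lam mu : ℕ → ℕ) (r : ℕ) : ℕ := max (lam (r + 1)) (mu r)

/-- The greatest possible length of row `r` in a shape between `mu` and `lam`. -/
def rowHi (lam mu : ℕ → ℕ) (r : ℕ) : ℕ :=
  if r = 0 then lam 0 else min (lam r) (mu (r - 1))

theorem sum_rowLo_add_rowHi {ℓ m k : ℕ} (hk : k ≤ ℓ) (lam mu : BoxedShape ℓ m) :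
    ∑ r ∈ Finset.Ico k ℓ, (rowLo lam mu r + rowHi lam mu r) + lam k =
      ∑ r ∈ Finset.Ico k ℓ, (lam r + mu r) + rowHi lam mu k := by
  induction hk using Nat.decreasingInduction with
  | self =>
    have := lam.eq_zero le_rfl
    rcases Nat.eq_zero_or_pos ℓ with rfl | h
    · simp [rowHi]
    · simp [rowHi, this, h.ne']
  | of_succ k hk ih =>
    rw [Finset.sum_eq_sum_Ico_succ_bot hk, Finset.sum_eq_sum_Ico_succ_bot hk]
    have : rowLo lam mu k + rowHi lam mu (k + 1) = lam (k + 1) + mu k := by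
      simp [rowLo, rowHi]
    omega

theorem rowHi_le {ℓ m : ℕ} (lam mu : BoxedShape ℓ m) (r : ℕ) : rowHi lam mu r ≤ lam r := by
  unfold rowHi
  split_ifs with h
  · rw [h]
  · exact min_le_left _ _

theorem rowHi_succ_le {ℓ m : ℕ} (lam mu : BoxedShape ℓ m) (r : ℕ) :
    rowHi lam mu (r + 1) ≤ rowLo lam mu r := by
  simp [rowHi, rowLo]

/-- The rows of `s` of index at least `k` lie between `rowLo lam mu` and `rowHi lam mu`. -/
def IsBetween {ℓ m : ℕ} (k : ℕ) (lam mu s : BoxedShape ℓ m) : Prop :=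
  ∀ r, k ≤ r → rowLo lam mu r ≤ s r ∧ s r ≤ rowHi lam mu r

/-- Reflect the rows of index at least `k` in the interval of their possible lengths, and
replace the first `k` rows by those of `top`. -/
def reflectFrom {ℓ m : ℕ} (k : ℕ) (lam mu top s : BoxedShape ℓ m) (hs : IsBetween k lam mu s)
    (htop : ∀ r, r + 1 = k → rowHi lam mu k ≤ top r) : BoxedShape ℓ m :=
  ⟨fun r => if r < k then top r else rowLo lam mu r + rowHi lam mu r - s r, by
    refine antitone_nat_of_succ_le fun r => ?_
    rcases lt_trichotomy (r + 1) k with h | h | h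
    · rw [if_pos h, if_pos (by omega)]
      exact top.succ_le r
    · rw [if_neg (by omega), if_pos (by omega)]
      subst h
      have := htop r rfl
      have := hs (r + 1) le_rfl
      omega
    · rw [if_neg (by omega), if_neg (by omega)]
      have := hs r (by omega)
      have := hs (r + 1) (by omega)
      have := rowHi_succ_le lam mu r
      omega, by
    intro r hr
    have := top.eq_zero hr
    have := lam.eq_zero hr
    have := rowHi_le lam mu r
    dsimp only
    split_ifs with h
    · assumption
    · have := hs r (by omega)
      omega, by
    intro r
    have := top.le_width r
    have := lam.le_width r
    have := rowHi_le lam mu r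
    dsimp only
    split_ifs with h
    · assumption
    · have := hs r (by omega)
      omega⟩

section Reflect

variable {ℓ m k : ℕ} {lam mu top s : BoxedShape ℓ m} {hs : IsBetween k lam mu s}
  {htop : ∀ r, r + 1 = k → rowHi lam mu k ≤ top r}

theorem reflectFrom_of_lt {r : ℕ} (h : r < k) : reflectFrom k lam mu top s hs htop r = top r :=
  if_pos h

theorem reflectFrom_of_le {r : ℕ} (h : k ≤ r) :
    reflectFrom k lam mu top s hs htop r = rowLo lam mu r + rowHi lam mu r - s r :=
  if_neg (by omega)

theorem isBetween_reflectFrom : IsBetween k lam mu (reflectFrom k lam mu top s hs htop) := by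
  intro r hr
  rw [reflectFrom_of_le hr]
  have := hs r hr
  omega

end Reflect

theorem step_strip_support_iff {ℓ m k : ℕ} (lam mu s : BoxedShape ℓ m) :
    (((∀ r, mu r ≤ s r ∧ s (r + 1) ≤ mu r) ∧ ∀ r < k, s r = mu r) ∧
      (∀ r, s r ≤ lam r) ∧ ∀ r, k ≤ r → lam (r + 1) ≤ s r) ↔
    (∀ r < k, mu r ≤ lam r) ∧ (∀ r < k, s r = mu r) ∧ IsBetween k lam mu s := by
  constructor
  · rintro ⟨⟨h₁, h₂⟩, h₃, h₄⟩
    refine ⟨fun r _ => (h₁ r).1.trans (h₃ r), h₂, fun r hr => ⟨max_le (h₄ r hr) (h₁ r).1, ?_⟩⟩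
    rcases r with _ | r
    · exact h₃ 0
    · exact le_min (h₃ _) (h₁ r).2
  · rintro ⟨h₁, h₂, h₃⟩
    refine ⟨⟨fun r => ⟨?_, ?_⟩, h₂⟩, fun r => ?_, fun r hr => (le_max_left _ _).trans (h₃ r hr).1⟩
    · by_cases h : r < k
      · exact (h₂ r h).ge
      · exact (le_max_right _ _).trans (h₃ r (not_lt.1 h)).1
    · by_cases h : r + 1 < k
      · rw [h₂ _ h]
        exact mu.succ_le r
      · exact (h₃ _ (not_lt.1 h)).2.trans (min_le_right _ _)
    · by_cases h : r < k
      · exact (h₂ r h).trans_le (h₁ r h)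
      · exact (h₃ r (not_lt.1 h)).2.trans (rowHi_le lam mu r)

theorem strip_step_support_iff {ℓ m k : ℕ} (lam mu s : BoxedShape ℓ m) :
    (((∀ r, mu r ≤ s r) ∧ ∀ r, k - 1 ≤ r → s (r + 1) ≤ mu r) ∧
      (∀ r, s r ≤ lam r ∧ lam (r + 1) ≤ s r) ∧ ∀ r < k, lam r = s r) ↔
    (∀ r < k, mu r ≤ lam r) ∧ (∀ r < k, s r = lam r) ∧ IsBetween k lam mu s := by
  constructor
  · rintro ⟨⟨h₁, h₂⟩, h₃, h₄⟩
    refine ⟨fun r _ => (h₁ r).trans (h₃ r).1, fun r hr => (h₄ r hr).symm,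
      fun r hr => ⟨max_le (h₃ r).2 (h₁ r), ?_⟩⟩
    rcases r with _ | r
    · exact (h₃ 0).1
    · exact le_min (h₃ _).1 (h₂ r (by omega))
  · rintro ⟨h₁, h₂, h₃⟩
    refine ⟨⟨fun r => ?_, fun r hr => ?_⟩, fun r => ⟨?_, ?_⟩, fun r hr => (h₂ r hr).symm⟩
    · by_cases h : r < k
      · exact (h₁ r h).trans (h₂ r h).ge
      · exact (le_max_right _ _).trans (h₃ r (not_lt.1 h)).1
    · exact (h₃ _ (by omega)).2.trans (min_le_right _ _)
    · by_cases h : r < k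
      · exact (h₂ r h).le
      · exact (h₃ r (not_lt.1 h)).2.trans (rowHi_le lam mu r)
    · by_cases h : r < k
      · rw [h₂ _ h]
        exact lam.succ_le r
      · exact (le_max_left _ _).trans (h₃ r (not_lt.1 h)).1

theorem step_strip_weight_eq {ℓ m k : ℕ} (hk : k ≤ ℓ) (t : ℕ → R) (x y : R)
    (hy : 1 ≤ k → y = t k) {lam mu s s' : BoxedShape ℓ m} (hle : ∀ r < k, mu r ≤ lam r)
    (hs : ∀ r < k, s r = mu r) (hs' : ∀ r < k, s' r = lam r) (hb : IsBetween k lam mu s)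
    (hadd : ∀ r, k ≤ r → s r + s' r = rowLo lam mu r + rowHi lam mu r) :
    (∏ r ∈ Finset.range k,
        t (r + 1) ^ (lam (r + 1) - s r) * x ^ (lam r - max (s r) (lam (r + 1)))) *
      x ^ (∑ r ∈ Finset.Ico k ℓ, (lam r - s r)) * y ^ (∑ r ∈ Finset.Ico k ℓ, (s r - mu r)) =
    y ^ (∑ r ∈ Finset.Ico k ℓ, (lam r - s' r)) *
      ((∏ r ∈ Finset.range (k - 1),
        t (r + 1) ^ (s' (r + 1) - mu r) * x ^ (s' r - max (mu r) (s' (r + 1)))) *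
      x ^ (∑ r ∈ Finset.Ico (k - 1) ℓ, (s' r - mu r))) := by
  have hsum := sum_rowLo_add_rowHi hk lam mu
  have hbd : ∀ r ∈ Finset.Ico k ℓ, mu r ≤ s r ∧ s r ≤ lam r ∧ mu r ≤ s' r ∧ s' r ≤ lam r := by
    intro r hr
    have hr := (Finset.mem_Ico.1 hr).1
    have := hadd r hr
    have h₁ := hb r hr
    have h₂ := rowHi_le lam mu r
    have h₃ : mu r ≤ rowLo lam mu r := le_max_right _ _
    omega
  have e₁ : ∑ r ∈ Finset.Ico k ℓ, (lam r - s r) + ∑ r ∈ Finset.Ico k ℓ, s r =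
      ∑ r ∈ Finset.Ico k ℓ, lam r := by
    rw [← Finset.sum_add_distrib]
    exact Finset.sum_congr rfl fun r hr => by have := hbd r hr; omega
  have e₂ : ∑ r ∈ Finset.Ico k ℓ, (s r - mu r) + ∑ r ∈ Finset.Ico k ℓ, mu r =
      ∑ r ∈ Finset.Ico k ℓ, s r := by
    rw [← Finset.sum_add_distrib]
    exact Finset.sum_congr rfl fun r hr => by have := hbd r hr; omega
  have e₃ : ∑ r ∈ Finset.Ico k ℓ, (lam r - s' r) + ∑ r ∈ Finset.Ico k ℓ, s' r =
      ∑ r ∈ Finset.Ico k ℓ, lam r := by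
    rw [← Finset.sum_add_distrib]
    exact Finset.sum_congr rfl fun r hr => by have := hbd r hr; omega
  have e₄ : ∑ r ∈ Finset.Ico k ℓ, (s' r - mu r) + ∑ r ∈ Finset.Ico k ℓ, mu r =
      ∑ r ∈ Finset.Ico k ℓ, s' r := by
    rw [← Finset.sum_add_distrib]
    exact Finset.sum_congr rfl fun r hr => by have := hbd r hr; omega
  have e₅ : ∑ r ∈ Finset.Ico k ℓ, s r + ∑ r ∈ Finset.Ico k ℓ, s' r =
      ∑ r ∈ Finset.Ico k ℓ, (rowLo lam mu r + rowHi lam mu r) := by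
    rw [← Finset.sum_add_distrib]
    exact Finset.sum_congr rfl fun r hr => hadd r (Finset.mem_Ico.1 hr).1
  rw [Finset.sum_add_distrib (f := fun r => lam r)] at hsum
  rcases k with _ | k
  · have : rowHi lam mu 0 = lam 0 := if_pos rfl
    rw [show ∑ r ∈ Finset.Ico 0 ℓ, (lam r - s' r) = ∑ r ∈ Finset.Ico 0 ℓ, (s r - mu r) by omega,
      show ∑ r ∈ Finset.Ico (0 - 1) ℓ, (s' r - mu r) = ∑ r ∈ Finset.Ico 0 ℓ, (lam r - s r) by
        simp only [Nat.zero_sub]; omega]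
    simp [mul_comm]
  · have hhi : rowHi lam mu (k + 1) = min (lam (k + 1)) (mu k) := by simp [rowHi]
    have h₀ := hle k k.lt_succ_self
    have h₀' := lam.succ_le k
    rw [hy (by omega), Finset.prod_range_succ, Nat.add_sub_cancel,
      Finset.sum_eq_sum_Ico_succ_bot (by omega : k < ℓ), hs k (by omega), hs' k (by omega)]
    have hp : ∏ r ∈ Finset.range k,
        t (r + 1) ^ (lam (r + 1) - s r) * x ^ (lam r - max (s r) (lam (r + 1))) =
        ∏ r ∈ Finset.range k,
        t (r + 1) ^ (s' (r + 1) - mu r) * x ^ (s' r - max (mu r) (s' (r + 1))) := by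
      refine Finset.prod_congr rfl fun r hr => ?_
      have hr := Finset.mem_range.1 hr
      rw [hs r (by omega), hs' r (by omega), hs' (r + 1) (by omega)]
    have ht : ∑ r ∈ Finset.Ico (k + 1) ℓ, (lam r - s' r) =
        (lam (k + 1) - mu k) + ∑ r ∈ Finset.Ico (k + 1) ℓ, (s r - mu r) := by
      omega
    have hx : lam k - mu k + ∑ r ∈ Finset.Ico (k + 1) ℓ, (s' r - mu r) =
        (lam k - max (mu k) (lam (k + 1))) + ∑ r ∈ Finset.Ico (k + 1) ℓ, (lam r - s r) := by
      omega
    rw [hp, ht, hx, pow_add, pow_add]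
    ring

theorem dualGrothStep_commute {ℓ m k : ℕ} (hk : k ≤ ℓ) (t : ℕ → R) (x y : R)
    (hy : 1 ≤ k → y = t k) (lam mu : BoxedShape ℓ m) :
    ∑ s : BoxedShape ℓ m, dualGrothStep ℓ (truncParam t k) x lam s * stripStep ℓ k y s mu =
      ∑ s : BoxedShape ℓ m,
        stripStep ℓ k y lam s * dualGrothStep ℓ (truncParam t (k - 1)) x s mu := by
  simp only [dualGrothStep_truncParam hk, dualGrothStep_truncParam ((Nat.sub_le k 1).trans hk),
    stripStep, ite_mul, mul_ite, zero_mul, mul_zero, ← ite_and]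
  rw [← Finset.sum_filter, ← Finset.sum_filter]
  simp only [step_strip_support_iff, strip_step_support_iff]
  have topLam : ∀ r, r + 1 = k → rowHi lam mu k ≤ lam r := fun r h =>
    (rowHi_le lam mu k).trans (lam.anti (by omega))
  have topMu : ∀ r, r + 1 = k → rowHi lam mu k ≤ mu r := by
    rintro r rfl
    exact min_le_right _ _
  refine Finset.sum_bij'
    (fun s hs => reflectFrom k lam mu lam s (Finset.mem_filter.1 hs).2.2.2 topLam)
    (fun s hs => reflectFrom k lam mu mu s (Finset.mem_filter.1 hs).2.2.2 topMu) ?_ ?_ ?_ ?_ ?_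
  · intro s hs
    exact Finset.mem_filter.2 ⟨Finset.mem_univ _, (Finset.mem_filter.1 hs).2.1,
      fun r hr => reflectFrom_of_lt hr, isBetween_reflectFrom⟩
  · intro s hs
    exact Finset.mem_filter.2 ⟨Finset.mem_univ _, (Finset.mem_filter.1 hs).2.1,
      fun r hr => reflectFrom_of_lt hr, isBetween_reflectFrom⟩
  · intro s hs
    obtain ⟨-, -, hs, hb⟩ := Finset.mem_filter.1 hs
    ext r
    by_cases h : r < k
    · rw [reflectFrom_of_lt h, hs r h]
    · have h := not_lt.1 h
      have := hb r h
      rw [reflectFrom_of_le h, reflectFrom_of_le h]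
      omega
  · intro s hs
    obtain ⟨-, -, hs, hb⟩ := Finset.mem_filter.1 hs
    ext r
    by_cases h : r < k
    · rw [reflectFrom_of_lt h, hs r h]
    · have h := not_lt.1 h
      have := hb r h
      rw [reflectFrom_of_le h, reflectFrom_of_le h]
      omega
  · intro s hs
    obtain ⟨-, hle, hs, hb⟩ := Finset.mem_filter.1 hs
    refine step_strip_weight_eq hk t x y hy hle hs (fun r hr => reflectFrom_of_lt hr) hb
      fun r hr => ?_
    have := hb r hr
    rw [reflectFrom_of_le hr]
    omega
section StepMatrix

variable {ℓ m : ℕ}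

open Matrix

/-- The matrix with entries `dualGrothStep`. -/
def dualGrothMatrix (ℓ m : ℕ) (t : ℕ → R) (x : R) :
    Matrix (BoxedShape ℓ m) (BoxedShape ℓ m) R :=
  Matrix.of fun lam mu => dualGrothStep ℓ t x lam mu

/-- The matrix with entries `stripStep`. -/
def stripMatrix (ℓ m k : ℕ) (y : R) : Matrix (BoxedShape ℓ m) (BoxedShape ℓ m) R :=
  Matrix.of fun lam mu => stripStep ℓ k y lam mu

/-- The generating matrix of elegant fillings with entries at most `k`: the entry `j` occurs
only below the first `j` rows and has weight `t j`. -/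
def elegantMatrix (ℓ m : ℕ) (t : ℕ → R) : ℕ → Matrix (BoxedShape ℓ m) (BoxedShape ℓ m) R
  | 0 => 1
  | k + 1 => stripMatrix ℓ m (k + 1) (t (k + 1)) * elegantMatrix ℓ m t k

/-- The matrix of skew Schur polynomials in the variables `t 1, …, t k`. -/
def skewSchurMatrix (ℓ m : ℕ) (t : ℕ → R) : ℕ → Matrix (BoxedShape ℓ m) (BoxedShape ℓ m) R
  | 0 => 1
  | k + 1 => stripMatrix ℓ m 0 (t (k + 1)) * skewSchurMatrix ℓ m t k

theorem dualGrothMatrix_truncParam_zero (t : ℕ → R) (x : R) :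
    dualGrothMatrix ℓ m (truncParam t 0) x = stripMatrix ℓ m 0 x :=
  Matrix.ext fun _ _ => dualGrothStep_truncParam_zero t x _ _

theorem dualGrothMatrix_truncParam_mul_stripMatrix {k : ℕ} (hk : k ≤ ℓ) (t : ℕ → R) (x y : R)
    (hy : 1 ≤ k → y = t k) :
    dualGrothMatrix ℓ m (truncParam t k) x * stripMatrix ℓ m k y =
      stripMatrix ℓ m k y * dualGrothMatrix ℓ m (truncParam t (k - 1)) x :=
  Matrix.ext fun lam mu => dualGrothStep_commute hk t x y hy lam mu

theorem stripMatrix_zero_commute (x y : R) :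
    stripMatrix ℓ m 0 x * stripMatrix ℓ m 0 y = stripMatrix ℓ m 0 y * stripMatrix ℓ m 0 x := by
  have := dualGrothMatrix_truncParam_mul_stripMatrix (m := m) (Nat.zero_le ℓ) 0 x y (by simp)
  rwa [Nat.zero_sub, dualGrothMatrix_truncParam_zero] at this

theorem dualGrothMatrix_mul_elegantMatrix (t : ℕ → R) (x : R) {k : ℕ} (hk : k ≤ ℓ) :
    dualGrothMatrix ℓ m (truncParam t k) x * elegantMatrix ℓ m t k =
      elegantMatrix ℓ m t k * stripMatrix ℓ m 0 x := by
  induction k with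
  | zero => rw [elegantMatrix, mul_one, one_mul, dualGrothMatrix_truncParam_zero]
  | succ k ih =>
    rw [elegantMatrix, ← mul_assoc, dualGrothMatrix_truncParam_mul_stripMatrix hk t x _ fun _ => rfl,
      Nat.add_sub_cancel, mul_assoc, ih (by omega), mul_assoc]

theorem stripMatrix_mul_skewSchurMatrix (t : ℕ → R) (x : R) (k : ℕ) :
    stripMatrix ℓ m 0 x * skewSchurMatrix ℓ m t k =
      skewSchurMatrix ℓ m t k * stripMatrix ℓ m 0 x := by
  induction k with
  | zero => rw [skewSchurMatrix, mul_one, one_mul]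
  | succ k ih =>
    rw [skewSchurMatrix, ← mul_assoc, stripMatrix_zero_commute, mul_assoc, ih, mul_assoc]

theorem stripStep_eq_of_forall_lt_eq {k : ℕ} (hk : k < ℓ) (y : R) {lam : BoxedShape ℓ m}
    (hlam : ∀ r ≤ k, lam r = m) (mu : BoxedShape ℓ m) :
    stripStep ℓ k y lam mu = stripStep ℓ 0 y lam mu := by
  unfold stripStep
  by_cases h : ∀ r, mu r ≤ lam r ∧ lam (r + 1) ≤ mu r
  · have h' : ∀ r < k, lam r = mu r := by
      intro r hr
      have h₁ := (h r).2
      have h₂ := mu.le_width r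
      rw [hlam _ (by omega)] at h₁ ⊢
      omega
    rw [if_pos ⟨h, h'⟩, if_pos ⟨h, by simp⟩,
      ← Finset.sum_Ico_consecutive _ (Nat.zero_le k) hk.le,
      Finset.sum_eq_zero (s := Finset.Ico 0 k), zero_add]
    intro r hr
    rw [h' r (Finset.mem_Ico.1 hr).2, Nat.sub_self]
  · rw [if_neg fun h' => h h'.1, if_neg fun h' => h h'.1]

theorem elegantMatrix_mulVec_eq (t : ℕ → R) (f : BoxedShape ℓ m → R) {k : ℕ} (hk : k < ℓ)
    {lam : BoxedShape ℓ m} (hlam : ∀ r ≤ k, lam r = m) :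
    (elegantMatrix ℓ m t k *ᵥ f) lam = (skewSchurMatrix ℓ m t k *ᵥ f) lam := by
  induction k generalizing lam with
  | zero => rfl
  | succ k ih =>
    rw [elegantMatrix, skewSchurMatrix, ← mulVec_mulVec, ← mulVec_mulVec]
    refine Finset.sum_congr rfl fun mu _ => ?_
    change stripStep ℓ (k + 1) (t (k + 1)) lam mu * (elegantMatrix ℓ m t k *ᵥ f) mu =
      stripStep ℓ 0 (t (k + 1)) lam mu * (skewSchurMatrix ℓ m t k *ᵥ f) mu
    rw [stripStep_eq_of_forall_lt_eq hk _ hlam]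
    by_cases h : ∀ r, mu r ≤ lam r ∧ lam (r + 1) ≤ mu r
    · rw [ih (by omega)]
      intro r hr
      have h₁ := (h r).2
      have h₂ := mu.le_width r
      rw [hlam _ (by omega)] at h₁
      omega
    · rw [stripStep, if_neg fun h' => h h'.1, zero_mul, zero_mul]

theorem stripStep_succ_empty (k : ℕ) (y : R) (lam : BoxedShape ℓ m) :
    stripStep ℓ (k + 1) y lam (BoxedShape.empty ℓ m) =
      if lam = BoxedShape.empty ℓ m then 1 else 0 := by
  unfold stripStep
  by_cases h : lam = BoxedShape.empty ℓ m
  · rw [if_pos h, h]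
    simp [BoxedShape.empty]
  · rw [if_neg h, if_neg]
    rintro ⟨-, h'⟩
    refine h (BoxedShape.ext fun r => ?_)
    have h₁ := h' 0 (by omega)
    have h₂ := lam.anti (Nat.zero_le r)
    simp only [BoxedShape.empty] at h₁ ⊢
    omega

theorem elegantMatrix_mulVec_single_empty (t : ℕ → R) (k : ℕ) :
    elegantMatrix ℓ m t k *ᵥ Pi.single (BoxedShape.empty ℓ m) 1 =
      Pi.single (BoxedShape.empty ℓ m) 1 := by
  induction k with
  | zero => exact one_mulVec _
  | succ k ih =>
    rw [elegantMatrix, ← mulVec_mulVec, ih, mulVec_single_one]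
    ext lam
    rw [Pi.single_apply]
    exact stripStep_succ_empty k _ lam

end StepMatrix

theorem isSkewRPP_zero_iff {ℓ n : ℕ} {lam : ℕ → ℕ} {T : YBox ℓ lam → Fin (n + 1)} :
    IsSkewRPP ℓ n lam (fun _ => 0) T ↔
      (∀ b, 1 ≤ (T b : ℕ)) ∧
      (∀ (r : Fin ℓ) (c c' : Fin (lam r.1)), (c : ℕ) ≤ (c' : ℕ) → T ⟨r, c⟩ ≤ T ⟨r, c'⟩) ∧
      (∀ (r r' : Fin ℓ) (c : Fin (lam r.1)) (c' : Fin (lam r'.1)),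
        (r : ℕ) ≤ (r' : ℕ) → (c : ℕ) = (c' : ℕ) → T ⟨r, c⟩ ≤ T ⟨r', c'⟩) := by
  simp only [IsSkewRPP, Nat.not_lt_zero, iff_false, Nat.zero_le, true_imp_iff,
    Nat.one_le_iff_ne_zero, ne_eq]

theorem boxWeight_zero (ℓ n : ℕ) (lam : ℕ → ℕ) (x t : ℕ → R) (T : YBox ℓ lam → Fin (n + 1))
    (b : YBox ℓ lam) :
    boxWeight ℓ n lam (fun _ => 0) x t T b =
      if ∃ (hr : (b.1 : ℕ) + 1 < ℓ) (hc : (b.2 : ℕ) < lam ((b.1 : ℕ) + 1)),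
        T ⟨⟨(b.1 : ℕ) + 1, hr⟩, ⟨(b.2 : ℕ), hc⟩⟩ = T b
      then t ((b.1 : ℕ) + 1) else x (T b : ℕ) :=
  if_pos (Nat.zero_le _)

theorem exists_le_forall_iff_lt {N : ℕ} (p : Fin N → Prop)
    (hp : ∀ c c' : Fin N, c ≤ c' → p c' → p c) : ∃ k ≤ N, ∀ c : Fin N, p c ↔ (c : ℕ) < k := by
  have hex : ∃ k, ∀ h : k < N, ¬ p ⟨k, h⟩ := ⟨N, fun h => (lt_irrefl _ h).elim⟩
  refine ⟨Nat.find hex, Nat.find_min' hex fun h => (lt_irrefl _ h).elim, fun c => ⟨fun h => ?_, ?_⟩⟩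
  · by_contra hc
    have hlt : Nat.find hex < N := (not_lt.1 hc).trans_lt c.2
    exact Nat.find_spec hex hlt (hp ⟨_, hlt⟩ c (not_lt.1 hc) h)
  · intro h
    have := Nat.find_min hex h
    push Not at this
    exact this.2

/-- The boxes of `T` with entries at most `n` form the shape `mu`. -/
def HasSubshape {ℓ n : ℕ} {lam : ℕ → ℕ} (T : YBox ℓ lam → Fin (n + 2)) (mu : ℕ → ℕ) : Prop :=
  (∀ r : Fin ℓ, mu r ≤ lam r) ∧ ∀ b, (T b : ℕ) ≤ n ↔ (b.2 : ℕ) < mu b.1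

section Subshape

variable {ℓ m n : ℕ} {lam : ℕ → ℕ}

theorem existsUnique_hasSubshape (s : BoxedShape ℓ m) (hlam : ∀ r < ℓ, lam r = s r)
    {T : YBox ℓ lam → Fin (n + 2)} (hT : IsSkewRPP ℓ (n + 1) lam (fun _ => 0) T) :
    ∃! mu : BoxedShape ℓ m, HasSubshape T mu := by
  obtain ⟨-, hrow, hcol⟩ := isSkewRPP_zero_iff.1 hT
  choose f hf₁ hf₂ using fun r : Fin ℓ =>
    exists_le_forall_iff_lt (fun c : Fin (lam r) => (T ⟨r, c⟩ : ℕ) ≤ n)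
      fun c c' h h' => (Fin.le_def.1 (hrow r c c' h)).trans h'
  have hanti : ∀ r r' : Fin ℓ, r ≤ r' → f r' ≤ f r := by
    intro r r' h
    by_contra hc
    have h₁ : f r < lam r' := by have := hf₁ r'; omega
    have h₂ : f r < lam r := by
      have := s.anti (a := r) (b := r') h
      rw [hlam _ r.2]
      rw [hlam _ r'.2] at h₁
      omega
    have h₃ := (hf₂ r' ⟨f r, h₁⟩).2 (not_le.1 hc)
    have h₄ := Fin.le_def.1 (hcol r r' ⟨f r, h₂⟩ ⟨f r, h₁⟩ h rfl)
    exact absurd ((hf₂ r ⟨f r, h₂⟩).1 (h₄.trans h₃)) (lt_irrefl _)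
  refine ⟨⟨fun r => if h : r < ℓ then f ⟨r, h⟩ else 0, fun a b h => ?_, fun r h => ?_,
    fun r => ?_⟩, ⟨fun r => ?_, fun b => ?_⟩, fun mu hmu => ?_⟩
  · dsimp only
    split_ifs with h₁ h₂
    · exact hanti _ _ h
    · omega
    · exact Nat.zero_le _
    · exact le_rfl
  · exact dif_neg (by omega)
  · dsimp only
    split_ifs with h
    · have := hf₁ ⟨r, h⟩
      have h₁ := hlam r h
      have := s.le_width r
      dsimp only at *
      omega
    · exact Nat.zero_le _
  · simpa using hf₁ r
  · simpa using hf₂ b.1 b.2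
  · ext r
    by_cases h : r < ℓ
    · simp only [h, dif_pos]
      have h₁ := hmu.1 ⟨r, h⟩
      have h₂ := hf₁ ⟨r, h⟩
      have h₃ : ∀ c : Fin (lam r), (c : ℕ) < mu r ↔ (c : ℕ) < f ⟨r, h⟩ := fun c =>
        (hmu.2 ⟨⟨r, h⟩, c⟩).symm.trans (hf₂ ⟨r, h⟩ c)
      dsimp only at h₁ h₂
      by_contra hne
      rcases lt_or_gt_of_ne hne with hlt | hlt
      · exact absurd ((h₃ ⟨_, hlt.trans_le h₂⟩).2 hlt) (lt_irrefl _)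
      · exact absurd ((h₃ ⟨_, hlt.trans_le h₁⟩).1 hlt) (lt_irrefl _)
    · rw [mu.eq_zero (not_lt.1 h)]
      exact (dif_neg h : (if h : r < ℓ then f ⟨r, h⟩ else 0) = 0).symm

/-- The restriction of a filling to a smaller shape, with large entries truncated to `n`. -/
def restrictFilling {mu : ℕ → ℕ} (hmu : ∀ r : Fin ℓ, mu r ≤ lam r)
    (T : YBox ℓ lam → Fin (n + 2)) : YBox ℓ mu → Fin (n + 1) :=
  fun b => ⟨min (T ⟨b.1, ⟨b.2, b.2.2.trans_le (hmu b.1)⟩⟩) n, by omega⟩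

/-- The extension of a filling to a larger shape by the entry `n + 1`. -/
def extendFilling (lam : ℕ → ℕ) {mu : ℕ → ℕ} (T : YBox ℓ mu → Fin (n + 1)) :
    YBox ℓ lam → Fin (n + 2) :=
  fun b => if h : (b.2 : ℕ) < mu b.1 then (T ⟨b.1, ⟨b.2, h⟩⟩).castSucc else Fin.last (n + 1)

theorem hasSubshape_extendFilling {mu : ℕ → ℕ} (hmu : ∀ r : Fin ℓ, mu r ≤ lam r)
    (T : YBox ℓ mu → Fin (n + 1)) : HasSubshape (extendFilling lam T) mu := by
  refine ⟨hmu, fun b => ?_⟩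
  unfold extendFilling
  split_ifs with h
  · simp only [h, iff_true, Fin.val_castSucc]
    omega
  · simp [h]

theorem HasSubshape.coe_restrictFilling {mu : ℕ → ℕ} {T : YBox ℓ lam → Fin (n + 2)}
    (hT : HasSubshape T mu) (b : YBox ℓ mu) :
    (restrictFilling hT.1 T b : ℕ) = T ⟨b.1, ⟨b.2, b.2.2.trans_le (hT.1 b.1)⟩⟩ :=
  min_eq_left ((hT.2 _).2 b.2.2)

theorem HasSubshape.coe_eq_of_le {mu : ℕ → ℕ} {T : YBox ℓ lam → Fin (n + 2)}
    (hT : HasSubshape T mu) {b : YBox ℓ lam} (hb : mu b.1 ≤ b.2) : (T b : ℕ) = n + 1 := by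
  have := (hT.2 b).not.2 (not_lt.2 hb)
  omega

theorem HasSubshape.isSkewRPP_restrictFilling {mu : ℕ → ℕ} {T : YBox ℓ lam → Fin (n + 2)}
    (hT : HasSubshape T mu) (h : IsSkewRPP ℓ (n + 1) lam (fun _ => 0) T) :
    IsSkewRPP ℓ n mu (fun _ => 0) (restrictFilling hT.1 T) := by
  obtain ⟨hpos, hrow, hcol⟩ := isSkewRPP_zero_iff.1 h
  refine isSkewRPP_zero_iff.2 ⟨fun b => ?_, fun r c c' hc => ?_, fun r r' c c' hr hc => ?_⟩
  · rw [hT.coe_restrictFilling]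
    exact hpos _
  · rw [Fin.le_def, hT.coe_restrictFilling, hT.coe_restrictFilling]
    exact hrow _ _ _ hc
  · rw [Fin.le_def, hT.coe_restrictFilling, hT.coe_restrictFilling]
    exact hcol _ _ _ _ hr hc

theorem isSkewRPP_extendFilling (mu : BoxedShape ℓ m) {T : YBox ℓ mu → Fin (n + 1)}
    (h : IsSkewRPP ℓ n mu (fun _ => 0) T) :
    IsSkewRPP ℓ (n + 1) lam (fun _ => 0) (extendFilling lam T) := by
  obtain ⟨hpos, hrow, hcol⟩ := isSkewRPP_zero_iff.1 h
  refine isSkewRPP_zero_iff.2 ⟨fun b => ?_, fun r c c' hc => ?_, fun r r' c c' hr hc => ?_⟩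
  · unfold extendFilling
    split_ifs with hb
    · exact hpos _
    · simp
  · unfold extendFilling
    dsimp only
    split_ifs with h₁ h₂
    · exact hrow _ _ _ hc
    · exact Fin.le_last _
    · omega
    · exact le_rfl
  · unfold extendFilling
    have := mu.anti hr
    dsimp only
    split_ifs with h₁ h₂
    · exact hcol _ _ _ _ hr hc
    · exact Fin.le_last _
    · omega
    · exact le_rfl

theorem HasSubshape.extendFilling_restrictFilling {mu : ℕ → ℕ} {T : YBox ℓ lam → Fin (n + 2)}
    (hT : HasSubshape T mu) : extendFilling lam (restrictFilling hT.1 T) = T := by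
  funext b
  apply Fin.ext
  unfold extendFilling
  split_ifs with h
  · exact hT.coe_restrictFilling _
  · exact (hT.coe_eq_of_le (not_lt.1 h)).symm

theorem restrictFilling_extendFilling {mu : ℕ → ℕ} (hmu : ∀ r : Fin ℓ, mu r ≤ lam r)
    (T : YBox ℓ mu → Fin (n + 1)) : restrictFilling hmu (extendFilling lam T) = T := by
  funext b
  apply Fin.ext
  rw [(hasSubshape_extendFilling hmu T).coe_restrictFilling]
  simp [extendFilling]

theorem prod_fin_eq_prod_castLE_mul_prod_Ico {M N : ℕ} (h : M ≤ N) (f : Fin N → R) (φ : ℕ → R)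
    (hφ : ∀ c : Fin N, M ≤ c → f c = φ c) :
    ∏ c, f c = (∏ c ∈ Finset.Ico M N, φ c) * ∏ c : Fin M, f (Fin.castLE h c) := by
  set g : ℕ → R := fun c => if hc : c < N then f ⟨c, hc⟩ else 1 with hg
  have h₁ : ∏ c, f c = ∏ c ∈ Finset.range N, g c := by
    rw [← Fin.prod_univ_eq_prod_range]
    exact Finset.prod_congr rfl fun c _ => by simp [hg]
  have h₂ : ∏ c : Fin M, f (Fin.castLE h c) = ∏ c ∈ Finset.range M, g c := by
    rw [← Fin.prod_univ_eq_prod_range]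
    exact Finset.prod_congr rfl fun c _ => by
      simp only [hg, dif_pos (c.2.trans_le h)]
      rfl
  rw [h₁, h₂, ← Finset.prod_range_mul_prod_Ico _ h, mul_comm]
  congr 1
  refine Finset.prod_congr rfl fun c hc => ?_
  obtain ⟨hc₁, hc₂⟩ := Finset.mem_Ico.1 hc
  simp only [hg, dif_pos hc₂]
  exact hφ _ hc₁

theorem prod_Ico_ite_lt {M L N : ℕ} (hL : L ≤ N) (a b : R) :
    ∏ c ∈ Finset.Ico M N, (if c < L then a else b) = a ^ (L - M) * b ^ (N - max M L) := by
  have h₁ : (Finset.Ico M N).filter (fun c => c < L) = Finset.Ico M L := by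
    ext c
    simp only [Finset.mem_filter, Finset.mem_Ico]
    omega
  have h₂ : (Finset.Ico M N).filter (fun c => ¬ c < L) = Finset.Ico (max M L) N := by
    ext c
    simp only [Finset.mem_filter, Finset.mem_Ico]
    omega
  rw [Finset.prod_ite, Finset.prod_const, Finset.prod_const, h₁, h₂, Nat.card_Ico, Nat.card_Ico]

theorem HasSubshape.prod_boxWeight (x t : ℕ → R) {s mu : BoxedShape ℓ m}
    (hlam : ∀ r < ℓ, lam r = s r) {T : YBox ℓ lam → Fin (n + 2)} (hT : HasSubshape T mu) :
    ∏ b, boxWeight ℓ (n + 1) lam (fun _ => 0) x t T b =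
      dualGrothStep ℓ (fun r => t (r + 1)) (x (n + 1)) s mu *
        ∏ b, boxWeight ℓ n mu (fun _ => 0) x t (restrictFilling hT.1 T) b := by
  have hle : ∀ r, mu r ≤ s r := by
    intro r
    by_cases h : r < ℓ
    · exact (hT.1 ⟨r, h⟩).trans_eq (hlam r h)
    · rw [mu.eq_zero (not_lt.1 h)]
      exact Nat.zero_le _
  rw [dualGrothStep, if_pos hle, Fintype.prod_sigma, Fintype.prod_sigma,
    ← Fin.prod_univ_eq_prod_range
      (fun r => t (r + 1) ^ (s (r + 1) - mu r) * x (n + 1) ^ (s r - max (mu r) (s (r + 1)))) ℓ,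
    ← Finset.prod_mul_distrib]
  refine Finset.prod_congr rfl fun r _ => ?_
  rw [← prod_Ico_ite_lt (s.succ_le r), ← hlam r r.2]
  rw [prod_fin_eq_prod_castLE_mul_prod_Ico (hT.1 r) _
    (fun c => if c < s (r + 1) then t (r + 1) else x (n + 1))]
  · congr 1
    refine Finset.prod_congr rfl fun c _ => ?_
    have hmain : (T ⟨r, Fin.castLE (hT.1 r) c⟩ : ℕ) = restrictFilling hT.1 T ⟨r, c⟩ :=
      (hT.coe_restrictFilling ⟨r, c⟩).symm
    rw [boxWeight_zero, boxWeight_zero, hmain]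
    refine if_congr ?_ rfl rfl
    constructor
    · rintro ⟨hr, hc, he⟩
      have hle : (T ⟨⟨r + 1, hr⟩, ⟨c, hc⟩⟩ : ℕ) ≤ n := by
        have := (restrictFilling hT.1 T ⟨r, c⟩).2
        rw [← hmain, ← congrArg Fin.val he] at this
        exact Nat.le_of_lt_succ this
      refine ⟨hr, (hT.2 _).1 hle, Fin.ext ?_⟩
      rw [hT.coe_restrictFilling, ← hmain]
      exact congrArg Fin.val he
    · rintro ⟨hr, hc, he⟩
      refine ⟨hr, hc.trans_le (hT.1 ⟨r + 1, hr⟩), Fin.ext ?_⟩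
      rw [hmain, ← congrArg Fin.val he, hT.coe_restrictFilling]
      rfl
  · intro c hc
    have hTc : (T ⟨r, c⟩ : ℕ) = n + 1 := hT.coe_eq_of_le hc
    rw [boxWeight_zero, hTc]
    refine if_congr ⟨?_, fun h => ?_⟩ rfl rfl
    · rintro ⟨hr, hc', -⟩
      exact hc'.trans_eq (hlam _ hr)
    · have hr : (r : ℕ) + 1 < ℓ := by
        by_contra hr
        rw [s.eq_zero (not_lt.1 hr)] at h
        omega
      refine ⟨hr, h.trans_eq (hlam _ hr).symm, Fin.ext ?_⟩
      rw [hTc]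
      exact hT.coe_eq_of_le ((mu.succ_le r).trans hc)

theorem dualGroth_succ (x t : ℕ → R) (s : BoxedShape ℓ m) (hlam : ∀ r < ℓ, lam r = s r) :
    dualGroth ℓ (n + 1) lam (fun _ => 0) x t =
      ∑ mu : BoxedShape ℓ m, dualGrothStep ℓ (fun r => t (r + 1)) (x (n + 1)) s mu *
        dualGroth ℓ n mu (fun _ => 0) x t := by
  have hsplit : dualGroth ℓ (n + 1) lam (fun _ => 0) x t =
      ∑ mu : BoxedShape ℓ m, ∑ T ∈ Finset.univ.filter
        (fun T => IsSkewRPP ℓ (n + 1) lam (fun _ => 0) T ∧ HasSubshape T mu),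
        ∏ b, boxWeight ℓ (n + 1) lam (fun _ => 0) x t T b := by
    simp only [Finset.sum_filter]
    rw [Finset.sum_comm, dualGroth, Finset.sum_filter]
    refine Finset.sum_congr rfl fun T _ => ?_
    split_ifs with hT
    · obtain ⟨mu, hmu, huniq⟩ := existsUnique_hasSubshape s hlam hT
      rw [Finset.sum_eq_single mu]
      · rw [if_pos ⟨hT, hmu⟩]
      · exact fun mu' _ hne => if_neg fun h => hne (huniq _ h.2)
      · exact fun h => (h (Finset.mem_univ _)).elim
    · exact (Finset.sum_eq_zero fun mu _ => if_neg fun h => hT h.1).symm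
  rw [hsplit]
  refine Finset.sum_congr rfl fun mu _ => ?_
  by_cases hmu : ∀ r : Fin ℓ, mu r ≤ lam r
  · rw [dualGroth, Finset.mul_sum]
    refine Finset.sum_bij' (fun T _ => restrictFilling hmu T) (fun T _ => extendFilling lam T)
      ?_ ?_ ?_ ?_ ?_
    · intro T hT
      obtain ⟨-, hT, hsub⟩ := Finset.mem_filter.1 hT
      exact Finset.mem_filter.2 ⟨Finset.mem_univ _, hsub.isSkewRPP_restrictFilling hT⟩
    · intro T hT
      exact Finset.mem_filter.2 ⟨Finset.mem_univ _,
        isSkewRPP_extendFilling mu (Finset.mem_filter.1 hT).2, hasSubshape_extendFilling hmu T⟩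
    · intro T hT
      exact (Finset.mem_filter.1 hT).2.2.extendFilling_restrictFilling
    · intro T _
      exact restrictFilling_extendFilling hmu T
    · intro T hT
      exact (Finset.mem_filter.1 hT).2.2.prod_boxWeight x t hlam
  · rw [dualGrothStep, if_neg, zero_mul]
    · exact Finset.sum_eq_zero fun T hT => (hmu (Finset.mem_filter.1 hT).2.2.1).elim
    · exact fun h => hmu fun r => (h r).trans_eq (hlam r r.2).symm

end Subshape

theorem dualGroth_zero {ℓ m : ℕ} (x t : ℕ → R) (lam : BoxedShape ℓ m) :
    dualGroth ℓ 0 lam (fun _ => 0) x t = if lam = BoxedShape.empty ℓ m then 1 else 0 := by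
  split_ifs with h
  · subst h
    have : IsEmpty (YBox ℓ (BoxedShape.empty ℓ m)) := ⟨fun b => b.2.elim0⟩
    rw [dualGroth, Finset.filter_true_of_mem]
    · simp
    · exact fun T _ => isSkewRPP_zero_iff.2
        ⟨fun b => isEmptyElim b, fun _ c => c.elim0, fun _ _ c => c.elim0⟩
  · rw [dualGroth, Finset.filter_false_of_mem, Finset.sum_empty]
    intro T _ hT
    refine h (BoxedShape.ext fun r => ?_)
    change lam r = 0
    by_contra hne
    have hr : r < ℓ := by
      by_contra hr
      exact hne (lam.eq_zero (not_lt.1 hr))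
    have := (isSkewRPP_zero_iff.1 hT).1 ⟨⟨r, hr⟩, ⟨0, Nat.pos_of_ne_zero hne⟩⟩
    omega

theorem schurPoly_rect_eq_dualGroth (ℓ N m : ℕ) (z : ℕ → R) :
    schurPoly ℓ N (fun _ => m) z = dualGroth ℓ N (fun _ => m) (fun _ => 0) z 0 := by
  rw [schurPoly, dualGroth]
  have hsub : ∀ T : YBox ℓ (fun _ => m) → Fin (N + 1), IsSSYT ℓ N (fun _ => m) T →
      IsSkewRPP ℓ N (fun _ => m) (fun _ => 0) T := by
    rintro T ⟨h₁, h₂, h₃⟩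
    refine isSkewRPP_zero_iff.2 ⟨h₁, h₂, fun r r' c c' hr hc => ?_⟩
    rcases hr.lt_or_eq with hr | hr
    · exact (h₃ r r' c c' hr hc).le
    · exact h₂ r c c' hc.le |>.trans_eq (by rw [Fin.ext hr])
  refine Eq.trans ?_ (Finset.sum_subset (s₁ := Finset.univ.filter (IsSSYT ℓ N fun _ => m)) ?_ ?_)
  · refine Finset.sum_congr rfl fun T hT => Finset.prod_congr rfl fun b _ => ?_
    rw [boxWeight_zero, if_neg]
    rintro ⟨hr, hc, he⟩
    exact ((Finset.mem_filter.1 hT).2.2.2 b.1 ⟨b.1 + 1, hr⟩ b.2 ⟨b.2, hc⟩ (Nat.lt_succ_self _)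
      rfl).ne' he
  · exact fun T hT => Finset.mem_filter.2 ⟨Finset.mem_univ _, hsub T (Finset.mem_filter.1 hT).2⟩
  · intro T hT hT'
    obtain ⟨hpos, hrow, hcol⟩ := isSkewRPP_zero_iff.1 (Finset.mem_filter.1 hT).2
    have : ¬ IsSSYT ℓ N (fun _ => m) T := fun h =>
      hT' (Finset.mem_filter.2 ⟨Finset.mem_univ _, h⟩)
    have : ∃ (r r' : Fin ℓ) (c c' : Fin m), (r : ℕ) < r' ∧ (c : ℕ) = c' ∧
        T ⟨r', c'⟩ ≤ T ⟨r, c⟩ := by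
      by_contra hc
      push Not at hc
      exact this ⟨hpos, hrow, fun r r' c c' h₁ h₂ => hc r r' c c' h₁ h₂⟩
    obtain ⟨r, r', c, c', hr, hc, hle⟩ := this
    refine Finset.prod_eq_zero (Finset.mem_univ ⟨r, c⟩) ?_
    have hr₁ : (r : ℕ) + 1 < ℓ := by omega
    have heq : T ⟨⟨r + 1, hr₁⟩, c⟩ = T ⟨r, c⟩ :=
      le_antisymm ((hcol ⟨r + 1, hr₁⟩ r' c c' hr hc).trans hle)
        (hcol r ⟨r + 1, hr₁⟩ c c (Nat.le_succ _) rfl)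
    exact (boxWeight_zero ..).trans (if_pos ⟨hr₁, c.2, heq⟩)

section Littlewood

variable {ℓ m : ℕ}

open Matrix

/-- The dual Grothendieck polynomials in `n` variables of all shapes in the `ℓ × m` rectangle. -/
def dualGrothVec (ℓ m n : ℕ) (x t : ℕ → R) : BoxedShape ℓ m → R :=
  fun lam => dualGroth ℓ n lam (fun _ => 0) x t

theorem dualGrothVec_zero (x t : ℕ → R) :
    dualGrothVec ℓ m 0 x t = Pi.single (BoxedShape.empty ℓ m) 1 := by
  funext lam
  rw [Pi.single_apply]
  exact dualGroth_zero x t lam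

theorem dualGrothVec_succ (n : ℕ) (x t : ℕ → R) :
    dualGrothVec ℓ m (n + 1) x t =
      dualGrothMatrix ℓ m (fun r => t (r + 1)) (x (n + 1)) *ᵥ dualGrothVec ℓ m n x t :=
  funext fun lam => dualGroth_succ x t lam fun _ _ => rfl

theorem dualGrothMatrix_zero (x : R) : dualGrothMatrix ℓ m 0 x = stripMatrix ℓ m 0 x :=
  dualGrothMatrix_truncParam_zero 0 x

theorem dualGrothVec_succ_of_param_zero (n : ℕ) (x : ℕ → R) :
    dualGrothVec ℓ m (n + 1) x 0 = stripMatrix ℓ m 0 (x (n + 1)) *ᵥ dualGrothVec ℓ m n x 0 := by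
  rw [dualGrothVec_succ, ← dualGrothMatrix_zero]
  rfl

theorem dualGrothVec_congr_of_param_zero {n : ℕ} {x z : ℕ → R} (h : ∀ k ≤ n, z k = x k) :
    dualGrothVec ℓ m n z 0 = dualGrothVec ℓ m n x 0 := by
  induction n with
  | zero => rw [dualGrothVec_zero, dualGrothVec_zero]
  | succ n ih =>
    rw [dualGrothVec_succ_of_param_zero, dualGrothVec_succ_of_param_zero, h _ le_rfl,
      ih fun k hk => h k (by omega)]

theorem dualGrothVec_add_of_param_zero {n : ℕ} {t z : ℕ → R} (h : ∀ k, 1 ≤ k → z (n + k) = t k)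
    (j : ℕ) :
    dualGrothVec ℓ m (n + j) z 0 = skewSchurMatrix ℓ m t j *ᵥ dualGrothVec ℓ m n z 0 := by
  induction j with
  | zero => exact (one_mulVec _).symm
  | succ j ih =>
    rw [← add_assoc, dualGrothVec_succ_of_param_zero, ih, mulVec_mulVec, skewSchurMatrix, add_assoc,
      h _ (by omega)]

theorem dualGrothMatrix_eq_truncParam (q : ℕ) (t : ℕ → R) (x : R) :
    dualGrothMatrix (q + 1) m (fun r => t (r + 1)) x =
      dualGrothMatrix (q + 1) m (truncParam t q) x := by
  ext lam mu
  refine if_congr Iff.rfl (Finset.prod_congr rfl fun r hr => ?_) rfl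
  by_cases h : r < q
  · rw [truncParam, if_pos h]
  · have := Finset.mem_range.1 hr
    rw [lam.eq_zero (r := r + 1) (by omega), Nat.zero_sub, pow_zero, pow_zero]

theorem dualGrothVec_eq_elegantMatrix_mulVec (q n : ℕ) (x t : ℕ → R) :
    dualGrothVec (q + 1) m n x t =
      elegantMatrix (q + 1) m t q *ᵥ dualGrothVec (q + 1) m n x 0 := by
  induction n with
  | zero => rw [dualGrothVec_zero, dualGrothVec_zero, elegantMatrix_mulVec_single_empty]
  | succ n ih =>
    rw [dualGrothVec_succ, ih, dualGrothVec_succ_of_param_zero, dualGrothMatrix_eq_truncParam,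
      mulVec_mulVec, dualGrothMatrix_mul_elegantMatrix t _ (Nat.le_succ q), mulVec_mulVec]

theorem dualGrothStep_full (q : ℕ) (t : ℕ → R) (mu : BoxedShape (q + 1) m) :
    dualGrothStep (q + 1) (fun r => t (r + 1)) (t (q + 1)) (BoxedShape.full (q + 1) m) mu =
      ∏ i : Fin (q + 1), t (i.1 + 1) ^ (m - mu i) := by
  rw [dualGrothStep, if_pos, Fin.prod_univ_eq_prod_range (fun r => t (r + 1) ^ (m - mu r)),
    Finset.prod_range_succ, Finset.prod_range_succ]
  · congr 1
    · refine Finset.prod_congr rfl fun r hr => ?_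
      have hr := Finset.mem_range.1 hr
      rw [BoxedShape.full_apply (by omega), BoxedShape.full_apply (by omega),
        max_eq_right (mu.le_width r), Nat.sub_self, pow_zero, mul_one]
    · rw [BoxedShape.full_apply q.lt_succ_self, (BoxedShape.full (q + 1) m).eq_zero le_rfl]
      simp
  · intro r
    by_cases h : r < q + 1
    · rw [BoxedShape.full_apply h]
      exact mu.le_width r
    · rw [mu.eq_zero (not_lt.1 h)]
      exact Nat.zero_le _

/-- The boxed shape with the given row lengths. -/
def BoxedShape.ofFin (p : Fin ℓ → Fin (m + 1)) (hp : ∀ i j : Fin ℓ, i ≤ j → p j ≤ p i) :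
    BoxedShape ℓ m :=
  ⟨extendFin ℓ fun a => (p a : ℕ), fun a b h => by
    unfold extendFin
    split_ifs with h₁ h₂
    · exact hp _ _ h
    · omega
    · exact Nat.zero_le _
    · exact le_rfl, fun r h => dif_neg (by omega), fun r => by
    unfold extendFin
    split_ifs with h
    · exact Fin.is_le _
    · exact Nat.zero_le _⟩

theorem sum_boxedShape_eq (F : (ℕ → ℕ) → R) :
    ∑ s : BoxedShape ℓ m, F s =
      ∑ p ∈ Finset.univ.filter
          (fun p : Fin ℓ → Fin (m + 1) => ∀ i j : Fin ℓ, i ≤ j → p j ≤ p i),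
        F (extendFin ℓ fun a => (p a : ℕ)) := by
  refine Finset.sum_bij' (fun s _ r => ⟨s r, Nat.lt_succ_of_le (s.le_width r)⟩)
    (fun p hp => BoxedShape.ofFin p (Finset.mem_filter.1 hp).2) ?_ ?_ ?_ ?_ ?_
  · exact fun s _ => Finset.mem_filter.2 ⟨Finset.mem_univ _, fun i j h => s.anti h⟩
  · exact fun _ _ => Finset.mem_univ _
  · intro s _
    ext r
    by_cases h : r < ℓ
    · simp [BoxedShape.ofFin, extendFin, h]
    · simp [BoxedShape.ofFin, extendFin, h, s.eq_zero (not_lt.1 h)]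
  · intro p _
    funext r
    simp [BoxedShape.ofFin, extendFin]
  · intro s _
    congr 1
    funext r
    by_cases h : r < ℓ
    · simp [extendFin, h]
    · simp [extendFin, h, s.eq_zero (not_lt.1 h)]

end Littlewood

/-- **Littlewood identity for refined dual Grothendieck polynomials.**
For `m ≥ ℓ`,
`s_{m^ℓ}(x_1,…,x_n,t_1,…,t_ℓ) = Σ_{λ ⊆ m^ℓ} (∏_{i=1}^ℓ t_i^{m-λ_i}) g_λ(x;t)`.
Partitions `λ` contained in the `ℓ × m` rectangle are encoded as antitone
functions `p : Fin ℓ → Fin (m+1)`. -/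
theorem refined_dual_grothendieck_littlewood
    {R : Type*} [CommRing R] (m ℓ n : ℕ) (hml : ℓ ≤ m) (hl : 1 ≤ ℓ) (hn : 1 ≤ n)
    (x t : ℕ → R) :
    schurPoly ℓ (n + ℓ) (fun _ => m)
      (fun k => if k ≤ n then x k else t (k - n)) =
      ∑ p ∈ Finset.univ.filter
          (fun p : Fin ℓ → Fin (m + 1) => ∀ i j : Fin ℓ, i ≤ j → p j ≤ p i),
        (∏ i : Fin ℓ, t (i.1 + 1) ^ (m - (p i : ℕ))) *
          dualGroth ℓ n (extendFin ℓ fun a => (p a : ℕ)) (fun _ => 0) x t := by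
  obtain ⟨q, rfl⟩ : ∃ q, ℓ = q + 1 := ⟨ℓ - 1, by omega⟩
  set z : ℕ → R := fun k => if k ≤ n then x k else t (k - n) with hz
  have hzx : ∀ k ≤ n, z k = x k := fun k hk => if_pos hk
  have hzt : ∀ k, 1 ≤ k → z (n + k) = t k := fun k hk => by
    simp only [hz]
    rw [if_neg (by omega), Nat.add_sub_cancel_left]
  have hschur : schurPoly (q + 1) (n + (q + 1)) (fun _ => m) z =
      (stripMatrix (q + 1) m 0 (t (q + 1))).mulVec
        (dualGrothVec (q + 1) m (n + q) z 0) (BoxedShape.full (q + 1) m) := by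
    rw [schurPoly_rect_eq_dualGroth, ← hzt (q + 1) (by omega), ← dualGrothMatrix_zero]
    exact dualGroth_succ z 0 (BoxedShape.full (q + 1) m)
      fun r hr => (BoxedShape.full_apply hr).symm
  rw [hschur, dualGrothVec_add_of_param_zero hzt, dualGrothVec_congr_of_param_zero hzx,
    Matrix.mulVec_mulVec, stripMatrix_mul_skewSchurMatrix, ← Matrix.mulVec_mulVec,
    ← elegantMatrix_mulVec_eq t _ (Nat.lt_succ_self q)
      fun r hr => BoxedShape.full_apply (Nat.lt_succ_of_le hr),
    Matrix.mulVec_mulVec, ← dualGrothMatrix_mul_elegantMatrix t _ (Nat.le_succ q),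
    ← Matrix.mulVec_mulVec, ← dualGrothVec_eq_elegantMatrix_mulVec,
    ← dualGrothMatrix_eq_truncParam]
  have hsum := sum_boxedShape_eq (ℓ := q + 1) (m := m) fun lam : ℕ → ℕ =>
    (∏ i : Fin (q + 1), t (i.1 + 1) ^ (m - lam i)) * dualGroth (q + 1) n lam (fun _ => 0) x t
  simp only [extendFin, Fin.is_lt, dif_pos, Fin.eta] at hsum
  refine Eq.trans (Finset.sum_congr rfl fun mu _ => ?_) hsum
  exact congrArg (· * _) (dualGrothStep_full q t mu)

end
end

section
/- Let m, ℓ, n ≥ 1. For the rectangular partition m^ℓ, the refined dual Grothendieck polynomial is a Schur polynomial in the union of the x and t variables: g_{m^ℓ}(x_1,…,x_n; t_1,…,t_{ℓ−1}) = s_{m^ℓ}(x_1,…,x_n, t_1,…,t_{ℓ−1}). -/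
open scoped Classical

noncomputable section

variable {R : Type*} [CommRing R]

/-- The factor contributed by a box with entry `p` sitting directly above a box with entry `e`. -/
def stepWeight (x : ℕ → R) (τ : R) (p e : ℕ) : R :=
  if p < e then x p else if p = e then τ else 0

/-- The weight of a column, listed from bottom to top, whose entries are positive and bounded
by `C`; it vanishes on all other columns. -/
def colWeight {s N : ℕ} (x τ : ℕ → R) (C c : Fin (s + 1) → Fin (N + 1)) : R :=
  (∏ i, if 1 ≤ (c i : ℕ) ∧ c i ≤ C i then 1 else 0) *
    (x (c 0) * ∏ i : Fin s, stepWeight x (τ i) (c i.succ) (c i.castSucc))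

lemma sum_telescope {N : ℕ} (x A B : ℕ → R) (hB : ∀ e, B (e + 1) = B e + x (e + 1) * A (e + 1))
    (p : ℕ) (q : Fin (N + 1)) (hpq : p ≤ q) :
    ∑ e : Fin (N + 1), (if p < (e : ℕ) ∧ e ≤ q then x e * A e else 0) = B q - B p := by
  obtain ⟨q, hq⟩ := q
  simp only [Fin.le_def] at hpq ⊢
  rw [Fin.sum_univ_eq_sum_range (fun e => if p < e ∧ e ≤ q then x e * A e else 0) (N + 1)]
  rw [← Finset.sum_filter]
  have : (Finset.range (N + 1)).filter (fun e => p < e ∧ e ≤ q) = Finset.Ioc p q := by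
    ext e; simp; omega
  rw [this]
  clear this hq
  induction q, hpq using Nat.le_induction with
  | base => simp
  | succ q hq ih => rw [Finset.sum_Ioc_succ_top (by omega), ih, hB]; ring

lemma sum_colWeight_mul_alternating {M : Type*} [AddCommGroup M] [Module R M] {N : ℕ}
    (x : ℕ → R) (s : ℕ) : ∀ (τ : ℕ → R) (a b : ℕ → ℕ → M)
    (_ : ∀ i e, b i (e + 1) = b i e + x (e + 1) • a i (e + 1))
    (_ : ∀ i e, i < s → a (i + 1) e = b i e - τ i • a i e) (_ : b s 0 = 0)
    (C : Fin (s + 1) → Fin (N + 1)) (_ : Antitone C) (f : M [⋀^Fin (s + 1)]→ₗ[R] R),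
    ∑ c, colWeight x τ C c * f (fun i => a i (c i)) = f (fun i => b i (C i)) := by
  induction s with
  | zero =>
    intro τ a b h1 h2 h3 C hC f
    rw [← (Equiv.funUnique (Fin 1) (Fin (N + 1))).symm.sum_comp]
    have hc : ∀ v : M, (fun _ : Fin 1 => v) = Function.update (fun _ => 0) 0 v := by
      intro v; ext i; fin_cases i; simp
    have hadd : ∀ v w : M, f (fun _ => v + w) = f (fun _ => v) + f (fun _ => w) := by
      intro v w; rw [hc (v + w), hc v, hc w, f.map_update_add]
    have hsmul : ∀ (r : R) (v : M), f (fun _ => r • v) = r * f (fun _ => v) := by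
      intro r v; rw [hc (r • v), hc v, f.map_update_smul, smul_eq_mul]
    have key := sum_telescope x (fun e => f (fun _ => a 0 e)) (fun e => f (fun _ => b 0 e))
      (by intro e; simp only [h1, hadd, hsmul]) 0 (C 0) (Nat.zero_le _)
    have h0 : f (fun _ => b 0 0) = 0 := f.map_coord_zero 0 h3
    have hr : (fun i : Fin 1 => b i (C i)) = fun _ => b 0 (C 0) := by
      ext i; fin_cases i; rfl
    have hl : ∀ e : Fin (N + 1), (fun i : Fin 1 => a i e) = fun _ => a 0 e := by
      intro e; ext i; fin_cases i; rfl
    simp only [h0, sub_zero] at key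
    rw [hr, ← key]
    refine Finset.sum_congr rfl fun e _ => ?_
    simp only [colWeight, Equiv.funUnique_symm_apply, uniqueElim_const, hl,
      Finset.univ_eq_empty, Finset.prod_empty]
    simp [Nat.one_le_iff_ne_zero, Nat.pos_iff_ne_zero]
  | succ s ih =>
    intro τ a b h1 h2 h3 C hC f
    have key := ih (fun i => τ (i + 1)) (fun i => a (i + 1)) (fun i => b (i + 1))
      (fun i e => h1 _ e) (fun i e hi => h2 _ e (by omega)) h3 (fun i => C i.succ)
      (fun i j hij => hC (Fin.succ_le_succ_iff.2 hij)) (f.curryLeft (b 0 (C 0)))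
    have hr : (fun i : Fin (s + 2) => b i (C i)) =
        Matrix.vecCons (b 0 (C 0)) (fun i : Fin (s + 1) => b (i + 1) (C i.succ)) := by
      ext i; refine Fin.cases ?_ (fun i => ?_) i <;> simp
    rw [hr, ← f.curryLeft_apply_apply, ← key,
      ← (Fin.consEquiv (fun _ : Fin (s + 2) => Fin (N + 1))).sum_comp, Fintype.sum_prod_type_right]
    refine Finset.sum_congr rfl fun c _ => ?_
    set F : M → R := fun v => f.curryLeft v (fun i : Fin (s + 1) => a (i + 1) (c i)) with hF
    have hfa : ∀ e : Fin (N + 1), f (fun i => a i ((Fin.cons e c : Fin (s + 2) → _) i)) =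
        F (a 0 e) := by
      intro e
      rw [hF]; simp only [f.curryLeft_apply_apply]
      congr 1
      ext i; refine Fin.cases ?_ (fun i => ?_) i <;> simp
    have hadd : ∀ v w, F (v + w) = F v + F w := by intro v w; simp only [hF, map_add, AlternatingMap.add_apply]
    have hsmul : ∀ (r : R) w, F (r • w) = r * F w := by
      intro v w; simp only [hF, map_smul, AlternatingMap.smul_apply, smul_eq_mul]
    have hself : F (a 1 (c 0)) = 0 := by
      rw [hF]; simp only [f.curryLeft_apply_apply]
      exact f.map_eq_zero_of_eq _ (i := 0) (j := 1) (by simp) (by simp)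
    have hrel : F (b 0 (c 0)) = τ 0 * F (a 0 (c 0)) := by
      have : b 0 (c 0) = a 1 (c 0) + τ 0 • a 0 (c 0) := by
        rw [h2 0 _ (by omega)]; abel
      rw [this, hadd, hsmul, hself, zero_add]
    by_cases hc : 1 ≤ (c 0 : ℕ) ∧ c 0 ≤ C 1
    · have hc0 : c 0 ≤ C 0 := hc.2.trans (hC (Fin.zero_le _))
      have tel := sum_telescope x (fun e => F (a 0 e)) (fun e => F (b 0 e))
        (by intro e; simp only [h1, hadd, hsmul]) (c 0) (C 0) hc0
      have hsum : ∑ e : Fin (N + 1), (if 1 ≤ (e : ℕ) ∧ e ≤ C 0 then (1 : R) else 0) *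
          (x e * stepWeight x (τ 0) (c 0) e * F (a 0 e)) = x (c 0) * F (b 0 (C 0)) := by
        have : ∀ e : Fin (N + 1), (if 1 ≤ (e : ℕ) ∧ e ≤ C 0 then (1 : R) else 0) *
            (x e * stepWeight x (τ 0) (c 0) e * F (a 0 e)) =
            x (c 0) * (if (c 0 : ℕ) < e ∧ e ≤ C 0 then x e * F (a 0 e) else 0) +
              (if e = c 0 then x (c 0) * τ 0 * F (a 0 (c 0)) else 0) := by
          intro e
          rcases lt_trichotomy (c 0) e with h | h | h
          · have h' : (c 0 : ℕ) < e := h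
            have : 1 ≤ (e : ℕ) := by omega
            simp only [stepWeight, h', this, h.ne', true_and, if_true, if_false, add_zero]
            split_ifs <;> ring
          · subst h
            simp [stepWeight, hc.1, hc0]
          · have h' : (e : ℕ) < c 0 := h
            simp [stepWeight, h'.not_gt, h'.ne', h.ne]
        simp only [this, Finset.sum_add_distrib, ← Finset.mul_sum, tel]
        rw [Finset.sum_ite_eq' Finset.univ (c 0)]
        simp only [Finset.mem_univ, if_true, hrel]
        ring
      have e1 : f.curryLeft (b 0 (C 0)) (fun i : Fin (s + 1) => a (i + 1) (c i)) =
        F (b 0 (C 0)) := rfl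
      rw [e1]
      simp only [Fin.consEquiv_apply, hfa, colWeight]
      simp only [Fin.prod_univ_succ (n := s + 1), Fin.prod_univ_succ (n := s),
        Fin.cons_zero, Fin.cons_succ, Fin.castSucc_zero, ← Fin.succ_castSucc,
        Fin.val_zero, Fin.val_succ]
      set Q := ∏ i : Fin s, stepWeight x (τ (i + 1)) (c i.succ) (c i.castSucc)
      set I := ∏ i : Fin s, if 1 ≤ (c i.succ : ℕ) ∧ c i.succ ≤ C i.succ.succ then (1 : R) else 0
      set I0 := if 1 ≤ (c 0 : ℕ) ∧ c 0 ≤ C (Fin.succ 0) then (1 : R) else 0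
      calc _ = I0 * I * Q * (x (c 0) * F (b 0 (C 0))) := by
              rw [← hsum, Finset.mul_sum]
              refine Finset.sum_congr rfl fun e _ => ?_
              ring
        _ = _ := by ring
    · have z1 : ∀ e, colWeight x τ C (Fin.cons e c : Fin (s + 2) → Fin (N + 1)) = 0 := by
        intro e
        rw [colWeight, Finset.prod_eq_zero (Finset.mem_univ 1), zero_mul]
        rw [if_neg]; simpa using hc
      have z2 : colWeight x (fun i => τ (i + 1)) (fun i => C i.succ) c = 0 := by
        rw [colWeight, Finset.prod_eq_zero (Finset.mem_univ 0), zero_mul]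
        rw [if_neg]; simpa using hc
      rw [z2, zero_mul]
      refine Finset.sum_eq_zero fun e _ => ?_
      exact mul_eq_zero_of_left (z1 e) _

lemma bounded_antitone_of_colWeight_ne_zero {s N : ℕ} {x τ : ℕ → R}
    {C c : Fin (s + 1) → Fin (N + 1)} (h : colWeight x τ C c ≠ 0) :
    (∀ i, 1 ≤ (c i : ℕ) ∧ c i ≤ C i) ∧ Antitone c := by
  constructor
  · intro i
    by_contra hi
    exact h (by rw [colWeight, Finset.prod_eq_zero (Finset.mem_univ i) (if_neg hi), zero_mul])
  · refine Fin.antitone_iff_succ_le.2 fun i => ?_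
    by_contra hi
    rw [not_le, Fin.lt_def] at hi
    refine h ?_
    rw [colWeight, Finset.prod_eq_zero (Finset.mem_univ i) (by
      rw [stepWeight, if_neg (by omega), if_neg (by omega)]), mul_zero, mul_zero]

/-- The weight of a chain of columns `C ≥ T 0 ≥ T 1 ≥ …`. -/
def chainWeight {s N : ℕ} (x τ : ℕ → R) (m : ℕ) (C : Fin (s + 1) → Fin (N + 1))
    (T : Fin m → Fin (s + 1) → Fin (N + 1)) : R :=
  ∏ j : Fin m, colWeight x τ
    ((Fin.cons C T : Fin (m + 1) → Fin (s + 1) → Fin (N + 1)) j.castSucc) (T j)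

lemma sum_chainWeight_succ {s N : ℕ} (x τ : ℕ → R) (m : ℕ) (C : Fin (s + 1) → Fin (N + 1)) :
    ∑ T, chainWeight x τ (m + 1) C T = ∑ c, colWeight x τ C c * ∑ T, chainWeight x τ m c T := by
  rw [← (Fin.consEquiv (fun _ : Fin (m + 1) => Fin (s + 1) → Fin (N + 1))).sum_comp,
    Fintype.sum_prod_type]
  refine Finset.sum_congr rfl fun c _ => ?_
  rw [Finset.mul_sum]
  refine Finset.sum_congr rfl fun T _ => ?_
  change chainWeight x τ (m + 1) C (Fin.cons c T) = _
  simp only [chainWeight, Fin.prod_univ_succ (n := m), Fin.castSucc_zero, Fin.cons_zero,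
    Fin.cons_succ, ← Fin.succ_castSucc]

/-- The coefficient of `X ^ k` in `G`, which is `0` for negative `k`. -/
def intCoeff (G : PowerSeries R) (k : ℤ) : R := if 0 ≤ k then PowerSeries.coeff k.toNat G else 0

/-- The generating function of the complete homogeneous symmetric polynomials of
`z 1, …, z e`. -/
def completeGen (z : ℕ → R) (e : ℕ) : PowerSeries R :=
  ∏ j ∈ Finset.range e, PowerSeries.mk fun k => z (j + 1) ^ k

lemma completeGen_succ (z : ℕ → R) (e : ℕ) :
    completeGen z (e + 1) = completeGen z e + PowerSeries.C (z (e + 1)) * PowerSeries.X *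
      completeGen z (e + 1) := by
  have key : (PowerSeries.mk fun k => z (e + 1) ^ k) = 1 + PowerSeries.C (z (e + 1)) *
      PowerSeries.X * PowerSeries.mk fun k => z (e + 1) ^ k := by
    ext k
    rcases k with _ | k
    · simp [mul_assoc]
    · simp [mul_assoc, PowerSeries.coeff_succ_X_mul, PowerSeries.coeff_one, pow_succ']
  rw [completeGen, Finset.prod_range_succ, ← completeGen]
  nth_rewrite 1 [key]
  ring

lemma completeGen_zero (e : ℕ) : completeGen (fun _ => (0 : R)) e = 1 := by
  refine Finset.prod_eq_one fun j _ => ?_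
  ext k
  rcases k with _ | k <;> simp [PowerSeries.coeff_one]

lemma intCoeff_of_eq {G H : PowerSeries R} {a : R}
    (h : H = G + PowerSeries.C a * PowerSeries.X * H) (k : ℤ) :
    intCoeff H k = intCoeff G k + a * intCoeff H (k - 1) := by
  unfold intCoeff
  rcases lt_trichotomy k 0 with hk | rfl | hk
  · simp [show ¬ 0 ≤ k by omega, show ¬ 1 ≤ k by omega]
  · rw [h]; simp [mul_assoc]
  · obtain ⟨d, rfl⟩ : ∃ d : ℕ, k = d + 1 := ⟨(k - 1).toNat, by omega⟩
    have : ((d : ℤ) + 1).toNat = d + 1 := by omega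
    simp only [hk.le, if_true, this, add_sub_cancel_right, Int.natCast_nonneg, Int.toNat_natCast]
    nth_rewrite 1 [h]
    simp [mul_assoc, PowerSeries.coeff_succ_X_mul]

lemma intCoeff_eq_one {G : PowerSeries R} (h : PowerSeries.constantCoeff G = 1) :
    intCoeff G 0 = 1 := by
  simp [intCoeff, h]

lemma constantCoeff_completeGen (z : ℕ → R) (e : ℕ) :
    PowerSeries.constantCoeff (completeGen z e) = 1 := by
  rw [completeGen, map_prod]
  refine Finset.prod_eq_one fun j _ => ?_
  rw [← PowerSeries.coeff_zero_eq_constantCoeff_apply]; simp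

/-- A Jacobi–Trudi formula for chains of columns bounded by `C`. -/
lemma sum_chainWeight_eq_det {s N : ℕ} (x t : ℕ → R) (m : ℕ) :
    ∀ C : Fin (s + 1) → Fin (N + 1), Antitone C →
    ∑ T, chainWeight x (fun i => t (s - i)) m C T =
      Matrix.det (Matrix.of fun i j : Fin (s + 1) =>
        intCoeff (completeGen x (C i) * completeGen t (s - i)) (m + i - j)) := by
  induction m with
  | zero =>
    intro C hC
    rw [Matrix.det_of_isLowerTriangular]
    · symm
      simp only [Matrix.of_apply]
      simp [chainWeight, intCoeff_eq_one, constantCoeff_completeGen]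
    · intro i j hij
      have : (i : ℕ) < j := hij
      simp [intCoeff]
      omega
  | succ m ih =>
    intro C hC
    set P : ℕ → ℕ → ℤ → R := fun i e k => intCoeff (completeGen x e * completeGen t (s - i)) k
      with hP
    have key := sum_colWeight_mul_alternating x s (fun i => t (s - i))
      (fun i e (j : Fin (s + 1)) => P i e (m + i - j))
      (fun i e (j : Fin (s + 1)) => P i e ((m + 1 : ℕ) + i - j)) ?_ ?_ ?_ C hC
      Matrix.detRowAlternating
    · rw [sum_chainWeight_succ]
      refine Eq.trans (Finset.sum_congr rfl fun c _ => ?_) key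
      by_cases hc : colWeight x (fun i => t (s - i)) C c = 0
      · rw [hc, zero_mul, zero_mul]
      · rw [ih c (bounded_antitone_of_colWeight_ne_zero hc).2]
        rfl
    · intro i e
      ext j
      simp only [Pi.add_apply, Pi.smul_apply, smul_eq_mul, hP]
      rw [intCoeff_of_eq (G := completeGen x e * completeGen t (s - i)) (a := x (e + 1))]
      · congr 3; push_cast; ring
      · nth_rewrite 1 [completeGen_succ]; ring
    · intro i e hi
      ext j
      simp only [Pi.sub_apply, Pi.smul_apply, smul_eq_mul, hP]
      have hs : s - i = s - (i + 1) + 1 := by omega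
      rw [intCoeff_of_eq (H := completeGen x e * completeGen t (s - i))
        (G := completeGen x e * completeGen t (s - (i + 1))) (a := t (s - i))]
      · rw [show ((m + 1 : ℕ) : ℤ) + i - j - 1 = m + i - j by push_cast; ring,
          show ((m + 1 : ℕ) : ℤ) + i - j = m + (i + 1 : ℕ) - j by push_cast; ring]
        ring
      · rw [hs]; nth_rewrite 1 [completeGen_succ]; ring
    · ext j
      have h1 : (0 : ℤ) ≤ (m + 1 : ℕ) + s - j := by have := j.2; omega
      have h2 : (((m + 1 : ℕ) : ℤ) + s - j).toNat ≠ 0 := by have := j.2; omega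
      simp only [hP, intCoeff, if_pos h1, completeGen, Nat.sub_self, Finset.range_zero,
        Finset.prod_empty, mul_one, PowerSeries.coeff_one, if_neg h2, Pi.zero_apply]

/-- Fillings of a rectangle, listed as columns from right to left, each read from bottom to
top. -/
def rectEquiv (s m N : ℕ) : (Fin m → Fin (s + 1) → Fin (N + 1)) ≃
    (YBox (s + 1) (fun _ => m) → Fin (N + 1)) where
  toFun T b := T (Fin.rev b.2) (Fin.rev b.1)
  invFun U j i := U ⟨Fin.rev i, Fin.rev j⟩
  left_inv T := by ext; simp
  right_inv U := by ext; simp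

lemma isSkewRPP_rectEquiv_iff {s m N : ℕ} (T : Fin m → Fin (s + 1) → Fin (N + 1)) :
    IsSkewRPP (s + 1) N (fun _ => m) (fun _ => 0) (rectEquiv s m N T) ↔
      (∀ j i, 1 ≤ (T j i : ℕ)) ∧ Antitone T ∧ ∀ j, Antitone (T j) := by
  constructor
  · rintro ⟨h1, h2, h3⟩
    refine ⟨fun j i => ?_, fun j j' hj i => ?_, fun j i i' hi => ?_⟩
    · have := h1 ⟨Fin.rev i, Fin.rev j⟩
      simp [rectEquiv] at this
      have h : (T j i : ℕ) ≠ 0 := fun h => this (Fin.ext h)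
      omega
    · simpa [rectEquiv] using h2 (Fin.rev i) (Fin.rev j') (Fin.rev j) (Nat.zero_le _)
        (Fin.rev_le_rev.2 hj)
    · simpa [rectEquiv] using h3 (Fin.rev i') (Fin.rev i) (Fin.rev j) (Fin.rev j)
        (Fin.rev_le_rev.2 hi) rfl (Nat.zero_le _) (Nat.zero_le _)
  · rintro ⟨h1, h2, h3⟩
    refine ⟨fun b => ?_, fun r c c' _ hc => ?_, fun r r' c c' hr hc _ _ => ?_⟩
    · have := h1 (Fin.rev b.2) (Fin.rev b.1)
      simp only [rectEquiv, Equiv.coe_fn_mk, Nat.not_lt_zero, iff_false]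
      omega
    · exact h2 (Fin.rev_le_rev.2 hc) _
    · obtain rfl : c = c' := Fin.ext hc
      exact h3 _ (Fin.rev_le_rev.2 hr)

lemma prod_boxWeight_rectEquiv {s m N : ℕ} (x t : ℕ → R)
    (T : Fin m → Fin (s + 1) → Fin (N + 1)) (hT : ∀ j, Antitone (T j)) :
    ∏ b, boxWeight (s + 1) N (fun _ => m) (fun _ => 0) x t (rectEquiv s m N T) b =
      ∏ j, (x (T j 0) *
        ∏ i : Fin s, stepWeight x (t (s - i)) (T j i.succ) (T j i.castSucc)) := by
  rw [Fintype.prod_sigma, Finset.prod_comm, ← Equiv.prod_comp Fin.revPerm]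
  refine Finset.prod_congr rfl fun j _ => ?_
  rw [← Equiv.prod_comp Fin.revPerm, Fin.prod_univ_succ]
  congr 1
  · simp [boxWeight, rectEquiv]
  · refine Finset.prod_congr rfl fun i _ => ?_
    have hle : T j i.succ ≤ T j i.castSucc := hT j (Fin.castSucc_lt_succ).le
    have hi : s - (i + 1 : ℕ) + 1 = s - i := by have := i.2; omega
    have hrev : ∀ h, Fin.rev (⟨s - i, h⟩ : Fin (s + 1)) = i.castSucc := by
      intro h; ext; simp [Fin.val_rev]; have := i.2; omega
    have hrevj : ∀ h, Fin.rev (⟨m - (j + 1 : ℕ), h⟩ : Fin m) = j := by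
      intro h; ext; simp [Fin.val_rev]; have := j.2; omega
    have hj : m - (j + 1 : ℕ) < m := by have := j.2; omega
    have hs : s - (i : ℕ) < s + 1 := by omega
    simp only [boxWeight, rectEquiv, stepWeight, Fin.revPerm_apply, Equiv.coe_fn_mk,
      Fin.rev_rev, Fin.val_rev, Fin.val_succ, Nat.add_sub_add_right]
    rw [Fin.le_def] at hle
    rw [if_pos (Nat.zero_le _)]
    simp only [hi]
    simp only [hrev, hrevj, hj, hs, exists_true_left, Fin.ext_iff]
    split_ifs <;> first | rfl | omega

lemma dualGroth_rect_eq_sum_chainWeight (s m N : ℕ) (x t : ℕ → R) :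
    dualGroth (s + 1) N (fun _ => m) (fun _ => 0) x t =
      ∑ T, chainWeight x (fun i => t (s - i)) m (fun _ : Fin (s + 1) => Fin.last N) T := by
  rw [dualGroth, Finset.sum_filter, ← (rectEquiv s m N).sum_comp]
  refine Finset.sum_congr rfl fun T _ => ?_
  split_ifs with h
  · obtain ⟨h1, h2, h3⟩ := (isSkewRPP_rectEquiv_iff T).1 h
    rw [prod_boxWeight_rectEquiv x t T h3]
    refine Finset.prod_congr rfl fun j _ => ?_
    refine (Eq.trans (congrArg (· * _) (Finset.prod_eq_one fun i _ => if_pos ⟨h1 j i, ?_⟩))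
      (one_mul _)).symm
    obtain _ | m := m
    · exact j.elim0
    · refine Fin.cases ?_ (fun j => ?_) j
      · simp [Fin.le_last]
      · rw [← Fin.succ_castSucc, Fin.cons_succ]
        exact h2 (Fin.castSucc_lt_succ).le i
  · by_contra h0
    have hne : ∀ j, colWeight x (fun i => t (s - i)) _ (T j) ≠ 0 := fun j hj =>
      h0 (Finset.prod_eq_zero (Finset.mem_univ j) hj).symm
    refine h ((isSkewRPP_rectEquiv_iff T).2
      ⟨fun j i => ((bounded_antitone_of_colWeight_ne_zero (hne j)).1 i).1, ?_,
        fun j => (bounded_antitone_of_colWeight_ne_zero (hne j)).2⟩)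
    obtain _ | m := m
    · exact fun j => j.elim0
    · refine Fin.antitone_iff_succ_le.2 fun j i => ?_
      have := ((bounded_antitone_of_colWeight_ne_zero (hne j.succ)).1 i).2
      rwa [← Fin.succ_castSucc, Fin.cons_succ] at this

lemma schurPoly_eq_dualGroth (ℓ N : ℕ) (m : ℕ) (z : ℕ → R) :
    schurPoly ℓ N (fun _ => m) z = dualGroth ℓ N (fun _ => m) (fun _ => 0) z (fun _ => 0) := by
  refine Finset.sum_subset_zero_on_sdiff ?_ ?_ ?_
  · intro T hT
    obtain ⟨h1, h2, h3⟩ := (Finset.mem_filter.1 hT).2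
    refine Finset.mem_filter.2 ⟨Finset.mem_univ _, fun b => ?_, fun r c c' _ => h2 r c c',
      fun r r' c c' hr hc _ _ => ?_⟩
    · have := h1 b
      simp only [Nat.not_lt_zero, iff_false]
      omega
    · rcases hr.lt_or_eq with hr | hr
      · exact (h3 r r' c c' hr hc).le
      · obtain rfl := Fin.ext hr
        obtain rfl : c = c' := Fin.ext hc
        rfl
  · intro T hT
    rw [Finset.mem_sdiff, Finset.mem_filter, Finset.mem_filter] at hT
    obtain ⟨⟨-, h1, h2, h3⟩, hT⟩ := hT
    by_contra h0
    refine hT ⟨Finset.mem_univ _, fun b => ?_, fun r c c' => h2 r c c' (Nat.zero_le _),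
      fun r r' c c' hr hc => ?_⟩
    · have := (h1 b).not.2 (Nat.not_lt_zero _)
      omega
    · obtain rfl : c = c' := Fin.ext hc
      have hr1 : (r : ℕ) + 1 < ℓ := by have := r'.2; omega
      refine lt_of_lt_of_le (b := T ⟨⟨r + 1, hr1⟩, c⟩) (lt_of_le_of_ne ?_ ?_) ?_
      · exact h3 r ⟨r + 1, hr1⟩ c c (Nat.le_succ _) rfl (Nat.zero_le _) (Nat.zero_le _)
      · intro heq
        refine h0 (Finset.prod_eq_zero (Finset.mem_univ ⟨r, c⟩) ?_)
        rw [boxWeight, if_pos (Nat.zero_le _), if_pos ⟨hr1, c.2, heq.symm⟩]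
      · exact h3 ⟨r + 1, hr1⟩ r' c c hr rfl (Nat.zero_le _) (Nat.zero_le _)
  · intro T hT
    obtain ⟨h1, h2, h3⟩ := (Finset.mem_filter.1 hT).2
    refine Finset.prod_congr rfl fun b _ => ?_
    rw [boxWeight, if_pos (Nat.zero_le _), if_neg]
    rintro ⟨hr, hc, heq⟩
    exact (h3 b.1 ⟨b.1 + 1, hr⟩ b.2 b.2 (Nat.lt_succ_self _) rfl).ne' heq

lemma colWeight_zero_eq {s n : ℕ} (z : ℕ → R) (c : Fin (s + 1) → Fin (n + s + 1)) :
    colWeight z (fun _ => 0) (fun _ => Fin.last (n + s)) c =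
      colWeight z (fun _ => 0) (fun i => ⟨n + (s - i), by omega⟩) c := by
  unfold colWeight
  by_cases h : ∀ i : Fin s, c i.succ < c i.castSucc
  · congr 1
    refine Finset.prod_congr rfl fun i _ => ?_
    have hc : (c i : ℕ) + i ≤ n + s := by
      refine Fin.induction ?_ (fun i hi => ?_) i
      · simpa using (c 0).is_le
      · have := Fin.lt_def.1 (h i)
        simp only [Fin.val_castSucc, Fin.val_succ] at *
        omega
    have h2 : (c i : ℕ) ≤ n + (s - i) := by omega
    have h3 : (c i : ℕ) ≤ n + s := by omega
    simp [Fin.le_def, h2, h3]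
  · push Not at h
    obtain ⟨i, hi⟩ := h
    have : ∏ i : Fin s, stepWeight z 0 (c i.succ) (c i.castSucc) = 0 := by
      refine Finset.prod_eq_zero (Finset.mem_univ i) ?_
      rw [stepWeight, if_neg (not_lt.2 (Fin.le_def.1 hi)), ite_self]
    rw [this, mul_zero, mul_zero, mul_zero]

/-- For a rectangular shape `m^ℓ`, the refined dual Grothendieck polynomial is
a Schur polynomial in the union of the `x` and `t` alphabets:
`g_{m^ℓ}(x_1,…,x_n; t_1,…,t_{ℓ-1}) = s_{m^ℓ}(x_1,…,x_n,t_1,…,t_{ℓ-1})`. -/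
theorem refined_dual_grothendieck_rectangle
    {R : Type*} [CommRing R] (m ℓ n : ℕ) (hm : 1 ≤ m) (hl : 1 ≤ ℓ) (hn : 1 ≤ n)
    (x t : ℕ → R) :
    dualGroth ℓ n (fun _ => m) (fun _ => 0) x t =
      schurPoly ℓ (n + ℓ - 1) (fun _ => m)
        (fun k => if k ≤ n then x k else t (k - n)) := by
  obtain ⟨s, rfl⟩ : ∃ s, ℓ = s + 1 := ⟨ℓ - 1, by omega⟩
  obtain ⟨m, rfl⟩ : ∃ k, m = k + 1 := ⟨m - 1, by omega⟩
  set z : ℕ → R := fun k => if k ≤ n then x k else t (k - n) with hz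
  change _ = schurPoly (s + 1) (n + s) (fun _ => m + 1) z
  rw [schurPoly_eq_dualGroth, dualGroth_rect_eq_sum_chainWeight,
    dualGroth_rect_eq_sum_chainWeight, sum_chainWeight_eq_det x t _ _ antitone_const,
    sum_chainWeight_succ z]
  simp only [colWeight_zero_eq]
  rw [← sum_chainWeight_succ, sum_chainWeight_eq_det z (fun _ => 0)]
  · congr 1
    ext i j
    simp only [Matrix.of_apply, completeGen_zero, mul_one, Fin.val_last]
    congr 1
    simp only [completeGen, Finset.prod_range_add]
    congr 1
    · refine Finset.prod_congr rfl fun k hk => ?_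
      rw [hz]; simp [Nat.succ_le_of_lt (Finset.mem_range.1 hk)]
    · refine Finset.prod_congr rfl fun k _ => ?_
      rw [hz]; simp only
      rw [if_neg (by omega), show n + k + 1 - n = k + 1 by omega]
  · intro i i' h
    have : (i : ℕ) ≤ i' := h
    simp only [Fin.le_def]
    omega

end
end
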